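/- arXiv:2510.04119 — 2 statements merged into one kernel-verified Lean document; each statement's English description precedes it below -/
import Mathlib

section
/- For a q-super Manin matrix M, the recursion k \, str_{1,...,k}(\mathcal{A}_k^q M_1 \cdots M_k) = \sum_{i=0}^{k-1} (-1)^{k+i+1} str_{1,...,i}(\mathcal{A}_i^q M_1 \cdots M_i) \cdot str(M^{[k-i]}) holds in A. -/
open scoped BigOperators Classical
open Finset

namespace QSM

/-- Parity of a basis index of `ℂ^{m|n}`: `0` (even) for indices `< m`, `1` (odd) otherwise. -/
def pa (m : ℕ) {N : ℕ} (i : Fin N) : ℕ := if (i : ℕ) < m then 0 else 1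

/-- The sign `ε(i - j)`: `1` if `i > j`, `0` if `i = j`, `-1` if `i < j`. -/
def eps {N : ℕ} (i j : Fin N) : ℤ :=
  if (j : ℕ) < (i : ℕ) then 1 else if (i : ℕ) < (j : ℕ) then -1 else 0

variable {B : Type*} [Ring B] [Algebra ℂ B]

/-- Map a complex matrix into a matrix over the `ℂ`-algebra `B`. -/
noncomputable def cmap {I : Type*} (X : Matrix I I ℂ) : Matrix I I B :=
  X.map (algebraMap ℂ B)

/-- The super tensor product `E_{ij} ⊗ E_{kl}` of matrix units, as an operator on the
graded tensor square of `ℂ^{m|n}` (super sign conventions). -/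
noncomputable def stu (m : ℕ) {N : ℕ} (i j k l : Fin N) :
    Matrix (Fin N × Fin N) (Fin N × Fin N) ℂ :=
  Matrix.of fun p r =>
    ((-1 : ℂ) ^ ((pa m k + pa m l) * pa m r.1)) *
      (if p.1 = i ∧ r.1 = j then 1 else 0) * (if p.2 = k ∧ r.2 = l then 1 else 0)

/-- The operator `P^q = ∑_{i,j} q^{ε(i-j)} (-1)^{\bar j} E_{ij} ⊗ E_{ji}` on
`(ℂ^{m|n})^{⊗2}`. -/
noncomputable def Pq (q : ℂ) (m : ℕ) {N : ℕ} : Matrix (Fin N × Fin N) (Fin N × Fin N) ℂ :=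
  ∑ i : Fin N, ∑ j : Fin N, (q ^ eps i j * (-1 : ℂ) ^ pa m j) • stu m i j j i

/-- `M₁ = ∑ (-1)^{\bar i\bar j+\bar j} M_{ij} ⊗ E_{ij} ⊗ 1` on the tensor square. -/
noncomputable def Mone (m : ℕ) {N : ℕ} (M : Matrix (Fin N) (Fin N) B) :
    Matrix (Fin N × Fin N) (Fin N × Fin N) B :=
  Matrix.of fun p r =>
    if p.2 = r.2 then
      ((-1 : ℂ) ^ (pa m p.1 * pa m r.1 + pa m r.1)) • M p.1 r.1
    else 0

/-- `M₂ = ∑ (-1)^{\bar i\bar j+\bar j} M_{ij} ⊗ 1 ⊗ E_{ij}` on the tensor square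
(with the super sign of `1 ⊗ E_{ij}`). -/
noncomputable def Mtwo (m : ℕ) {N : ℕ} (M : Matrix (Fin N) (Fin N) B) :
    Matrix (Fin N × Fin N) (Fin N × Fin N) B :=
  Matrix.of fun p r =>
    if p.1 = r.1 then
      ((-1 : ℂ) ^ (pa m p.2 * pa m r.2 + pa m r.2 + (pa m p.2 + pa m r.2) * pa m r.1)) •
        M p.2 r.2
    else 0

/-- The `q`-super Manin matrix condition in matrix form:
`(1 - P^q) M₁ M₂ (1 + P^q) = 0`. -/
def IsManin (q : ℂ) (m : ℕ) {N : ℕ} (M : Matrix (Fin N) (Fin N) B) : Prop :=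
  (1 - cmap (Pq q m)) * Mone m M * Mtwo m M * (1 + cmap (Pq q m)) = 0

/-- The entrywise relations of the right quantum superalgebra `𝓜_{m|n}`. -/
def ManinRel (q : ℂ) (m : ℕ) {N : ℕ} (M : Matrix (Fin N) (Fin N) B) : Prop :=
  (∀ i j, pa m i = 1 → pa m j = 0 → M i j * M i j = 0) ∧
  (∀ i k l, pa m i = 1 →
    M i k * M i l = (q ^ eps l k * (-1 : ℂ) ^ ((pa m k + 1) * (pa m l + 1))) • (M i l * M i k)) ∧
  (∀ i j k, pa m k = 0 →
    M i k * M j k = (q ^ eps i j * (-1 : ℂ) ^ (pa m i * pa m j)) • (M j k * M i k)) ∧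
  (∀ i j k l,
    M i j * M k l -
        (q ^ (eps i k + eps l j) * (-1 : ℂ) ^ ((pa m i + pa m j) * (pa m k + pa m l))) •
          (M k l * M i j)
      = (q ^ eps i k * (-1 : ℂ) ^ (pa m i * pa m k + pa m j * pa m k + pa m i * pa m j)) •
            (M k j * M i l)
        - (q ^ eps l j * (-1 : ℂ) ^ (pa m j * pa m k + pa m j * pa m l + pa m k * pa m l)) •
            (M i l * M k j))

/-- The operator `P^q_σ` on `(ℂ^{m|n})^{⊗k}` (defined via reduced decompositions of `σ`;
equivalently, by the explicit inversion formula used here). -/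
noncomputable def Pperm (q : ℂ) (m : ℕ) {N k : ℕ} (σ : Equiv.Perm (Fin k)) :
    Matrix (Fin k → Fin N) (Fin k → Fin N) ℂ :=
  Matrix.of fun f g =>
    if f = g ∘ ⇑σ⁻¹ then
      ∏ p ∈ Finset.univ.filter (fun p : Fin k × Fin k => p.1 < p.2 ∧ σ p.2 < σ p.1),
        (q ^ eps (g p.1) (g p.2) * (-1 : ℂ) ^ (pa m (g p.1) * pa m (g p.2)))
    else 0

/-- The `q`-antisymmetrizer over the tensor positions in `S`. -/
noncomputable def AqS (q : ℂ) (m : ℕ) {N k : ℕ} (S : Finset (Fin k)) :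
    Matrix (Fin k → Fin N) (Fin k → Fin N) ℂ :=
  (S.card.factorial : ℂ)⁻¹ •
    ∑ σ ∈ Finset.univ.filter (fun σ : Equiv.Perm (Fin k) => ∀ t ∉ S, σ t = t),
      (((Equiv.Perm.sign σ : ℤ) : ℂ)) • Pperm q m (N := N) σ

/-- The `q`-symmetrizer over the tensor positions in `S`. -/
noncomputable def HqS (q : ℂ) (m : ℕ) {N k : ℕ} (S : Finset (Fin k)) :
    Matrix (Fin k → Fin N) (Fin k → Fin N) ℂ :=
  (S.card.factorial : ℂ)⁻¹ •
    ∑ σ ∈ Finset.univ.filter (fun σ : Equiv.Perm (Fin k) => ∀ t ∉ S, σ t = t),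
      Pperm q m (N := N) σ

/-- `M_a`: the copy of `M` in the `a`-th slot of `B ⊗ End(ℂ^{m|n})^{⊗k}`, with the super
sign factors `(-1)^{\bar i\bar j+\bar j}` and the super signs of `1⊗⋯⊗E_{ij}⊗⋯⊗1`. -/
noncomputable def Mslot (m : ℕ) {N k : ℕ} (M : Matrix (Fin N) (Fin N) B) (a : Fin k) :
    Matrix (Fin k → Fin N) (Fin k → Fin N) B :=
  Matrix.of fun f g =>
    if ∀ b, b ≠ a → f b = g b then
      ((-1 : ℂ) ^ (pa m (f a) * pa m (g a) + pa m (g a)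
          + (pa m (f a) + pa m (g a)) *
              ∑ b ∈ Finset.univ.filter (fun b => b < a), pa m (g b))) •
        M (f a) (g a)
    else 0

/-- The product `M₁ M₂ ⋯ M_k`. -/
noncomputable def MProd (m : ℕ) {N : ℕ} (M : Matrix (Fin N) (Fin N) B) (k : ℕ) :
    Matrix (Fin k → Fin N) (Fin k → Fin N) B :=
  (List.ofFn fun a : Fin k => Mslot m M a).prod

/-- The `q`-super Manin condition in the form `𝒜₂^q M₁ M₂ ℋ₂^q = 0`. -/
def IsManin2 (q : ℂ) (m : ℕ) {N : ℕ} (M : Matrix (Fin N) (Fin N) B) : Prop :=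
  cmap (AqS q m (Finset.univ : Finset (Fin 2))) * Mslot m M (0 : Fin 2) *
      Mslot m M (1 : Fin 2) * cmap (HqS q m (Finset.univ : Finset (Fin 2))) = 0

/-- The supertrace `str_{1,…,k}` over all `k` tensor slots. -/
noncomputable def strAll (m : ℕ) {N k : ℕ}
    (X : Matrix (Fin k → Fin N) (Fin k → Fin N) B) : B :=
  ∑ f : Fin k → Fin N, ((-1 : ℂ) ^ (∑ t, pa m (f t))) • X f f

/-- The supertrace of an `N × N` matrix. -/
noncomputable def strM (m : ℕ) {N : ℕ} (X : Matrix (Fin N) (Fin N) B) : B :=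
  ∑ i, ((-1 : ℂ) ^ pa m i) • X i i

/-- The star product `B * C = str₁ (P^q_{12} B₁ C₂)`. -/
noncomputable def starMul (q : ℂ) (m : ℕ) {N : ℕ} (X Y : Matrix (Fin N) (Fin N) B) :
    Matrix (Fin N) (Fin N) B :=
  Matrix.of fun i j =>
    ((-1 : ℂ) ^ (pa m i * pa m j + pa m j)) •
      ∑ a : Fin N, ((-1 : ℂ) ^ (pa m a * (1 + pa m i + pa m j))) •
        ((cmap (Pperm q m (Equiv.swap (0 : Fin 2) 1)) * Mslot m X (0 : Fin 2) *
            Mslot m Y (1 : Fin 2) :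
          Matrix (Fin 2 → Fin N) (Fin 2 → Fin N) B) ![a, i] ![a, j])

/-- The powers `M^{[k]}` of `M` with respect to the star product. -/
noncomputable def Mpow (q : ℂ) (m : ℕ) {N : ℕ} (M : Matrix (Fin N) (Fin N) B) :
    ℕ → Matrix (Fin N) (Fin N) B
  | 0 => 1
  | 1 => M
  | (j + 2) => starMul q m (Mpow q m M (j + 1)) M

/-- Coefficient of `t^k` in `A(t) = ∑ (-t)^k str_{1,…,k}(𝒜_k^q M₁⋯M_k)`. -/
noncomputable def coefA (q : ℂ) (m : ℕ) {N : ℕ} (M : Matrix (Fin N) (Fin N) B) (k : ℕ) : B :=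
  ((-1 : ℂ) ^ k) •
    strAll m (cmap (AqS q m (Finset.univ : Finset (Fin k))) * MProd m M k)

/-- Coefficient of `t^k` in `S(t) = ∑ t^k str_{1,…,k}(ℋ_k^q M₁⋯M_k)`. -/
noncomputable def coefS (q : ℂ) (m : ℕ) {N : ℕ} (M : Matrix (Fin N) (Fin N) B) (k : ℕ) : B :=
  strAll m (cmap (HqS q m (Finset.univ : Finset (Fin k))) * MProd m M k)

/-- Coefficient of `t^k` in `T(t) = ∑ t^k str(M^{[k+1]})`. -/
noncomputable def coefT (q : ℂ) (m : ℕ) {N : ℕ} (M : Matrix (Fin N) (Fin N) B) (k : ℕ) : B :=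
  strM m (Mpow q m M (k + 1))

/-- Coefficients `M^{i_1…i_k}_{j_1…j_k}` of `𝒜_k^q M₁⋯M_k` in the basis
`E_{i_1j_1} ⊗ ⋯ ⊗ E_{i_kj_k}` (super sign conventions). -/
noncomputable def MIJ (q : ℂ) (m : ℕ) {N k : ℕ} (M : Matrix (Fin N) (Fin N) B)
    (f g : Fin k → Fin N) : B :=
  ((-1 : ℂ) ^ (∑ a : Fin k, (pa m (f a) + pa m (g a)) *
      ∑ b ∈ Finset.univ.filter (fun b => b < a), pa m (g b))) •
    ((cmap (AqS q m (Finset.univ : Finset (Fin k))) * MProd m M k :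
      Matrix (Fin k → Fin N) (Fin k → Fin N) B) f g)

/-- Number of inversions (the length `l(σ)`) of a permutation. -/
def invCount {r : ℕ} (σ : Equiv.Perm (Fin r)) : ℕ :=
  (Finset.univ.filter fun p : Fin r × Fin r => p.1 < p.2 ∧ σ p.2 < σ p.1).card

/-- The quantum determinant `det_q(A) = ∑_σ (-q)^{-l(σ)} A_{σ(1),1} ⋯ A_{σ(r),r}`. -/
noncomputable def detq (q : ℂ) {r : ℕ} (A : Matrix (Fin r) (Fin r) B) : B :=
  ∑ σ : Equiv.Perm (Fin r),
    ((-q) ^ (-(invCount σ : ℤ))) • (List.ofFn fun i : Fin r => A (σ i) i).prod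

/-- The quantum Berezinian of a type `(r|s)` matrix `A` with (two-sided) inverse `Ainv`. -/
noncomputable def Ber (q : ℂ) (r s : ℕ) (A Ainv : Matrix (Fin (r + s)) (Fin (r + s)) B) : B :=
  (∑ σ : Equiv.Perm (Fin r), ((-q) ^ (-(invCount σ : ℤ))) •
      (List.ofFn fun i : Fin r => A (Fin.castAdd s (σ i)) (Fin.castAdd s i)).prod) *
  (∑ ρ : Equiv.Perm (Fin s), ((-q) ^ (-(invCount ρ : ℤ))) •
      (List.ofFn fun j : Fin s => Ainv (Fin.natAdd r j) (Fin.natAdd r (ρ j))).prod)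

/-- The `Π ∘ st` transform of a type `(r'|s')` matrix: a type `(s'|r')` matrix. -/
noncomputable def PiSt (r' s' : ℕ) (A : Matrix (Fin (r' + s')) (Fin (r' + s')) B) :
    Matrix (Fin (s' + r')) (Fin (s' + r')) B :=
  Matrix.of fun i j =>
    ((-1 : ℂ) ^ (pa s' i * (pa s' i + pa s' j))) •
      A (Fin.rev (Fin.cast (Nat.add_comm s' r') j)) (Fin.rev (Fin.cast (Nat.add_comm s' r') i))

/-- Left corner embedding `Fin a → Fin b`. -/
def embL (a b : ℕ) (h : a ≤ b) : Fin a → Fin b :=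
  fun i => ⟨(i : ℕ), lt_of_lt_of_le i.isLt h⟩

/-- Embedding of `Fin a` into `Fin b` shifted by `c`. -/
def embR (c a b : ℕ) (h : c + a ≤ b) : Fin a → Fin b :=
  fun i => ⟨c + (i : ℕ), by have := i.isLt; omega⟩

/-- `P^q ⊗ 1` on the triple tensor space. -/
noncomputable def P12 (q : ℂ) (m : ℕ) {N : ℕ} :
    Matrix (Fin N × Fin N × Fin N) (Fin N × Fin N × Fin N) ℂ :=
  Matrix.of fun p r =>
    Pq q m (p.1, p.2.1) (r.1, r.2.1) * (if p.2.2 = r.2.2 then 1 else 0)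

/-- `1 ⊗ P^q` on the triple tensor space (no extra super sign: `P^q` is even). -/
noncomputable def P23 (q : ℂ) (m : ℕ) {N : ℕ} :
    Matrix (Fin N × Fin N × Fin N) (Fin N × Fin N × Fin N) ℂ :=
  Matrix.of fun p r =>
    (if p.1 = r.1 then 1 else 0) * Pq q m (p.2.1, p.2.2) (r.2.1, r.2.2)

/-! ### Antisymmetrized sums of a function on permutations -/

section Antisymmetrize

variable {k : ℕ} {V : Type*} [AddCommGroup V] [Module ℂ V]

/-- Permutations of `Fin k` fixing every position `≥ i`. -/
def initialPerms (k i : ℕ) : Finset (Equiv.Perm (Fin k)) :=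
  Finset.univ.filter fun σ => ∀ t : Fin k, i ≤ (t : ℕ) → σ t = t

lemma mem_initialPerms {i : ℕ} {σ : Equiv.Perm (Fin k)} :
    σ ∈ initialPerms k i ↔ ∀ t : Fin k, i ≤ (t : ℕ) → σ t = t := by
  simp [initialPerms]

/-- The signed sum of `τ` over the left coset of `initialPerms k i` through `y`. -/
noncomputable def altSum (τ : Equiv.Perm (Fin k) → V) (i : ℕ) (y : Equiv.Perm (Fin k)) : V :=
  ∑ σ ∈ initialPerms k i, ((Equiv.Perm.sign σ : ℤ) : ℂ) • τ (y * σ)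

lemma swap_mem_initialPerms {i : ℕ} {x x' : Fin k} (hx : (x : ℕ) < i) (hx' : (x' : ℕ) < i) :
    Equiv.swap x x' ∈ initialPerms k i := by
  rw [mem_initialPerms]
  intro t ht
  apply Equiv.swap_apply_of_ne_of_ne <;> rintro rfl <;> omega

lemma mul_mem_initialPerms {i : ℕ} {σ ρ : Equiv.Perm (Fin k)} (hσ : σ ∈ initialPerms k i)
    (hρ : ρ ∈ initialPerms k i) : σ * ρ ∈ initialPerms k i := by
  rw [mem_initialPerms] at *
  intro t ht
  rw [Equiv.Perm.mul_apply, hρ t ht, hσ t ht]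

lemma sum_initialPerms_swap (F : Equiv.Perm (Fin k) → V) {i : ℕ} {x x' : Fin k}
    (hne : x ≠ x') (hx : (x : ℕ) < i) (hx' : (x' : ℕ) < i) :
    ∑ σ ∈ initialPerms k i, ((Equiv.Perm.sign σ : ℤ) : ℂ) • F (σ * Equiv.swap x x')
      = -∑ σ ∈ initialPerms k i, ((Equiv.Perm.sign σ : ℤ) : ℂ) • F σ := by
  rw [← Finset.sum_neg_distrib]
  refine Finset.sum_nbij' (fun σ => σ * Equiv.swap x x') (fun σ => σ * Equiv.swap x x')
    ?_ ?_ ?_ ?_ ?_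
  · exact fun σ hσ => mul_mem_initialPerms hσ (swap_mem_initialPerms hx hx')
  · exact fun σ hσ => mul_mem_initialPerms hσ (swap_mem_initialPerms hx hx')
  · intro σ _; simp [mul_assoc]
  · intro σ _; simp [mul_assoc]
  · intro σ _; simp [Equiv.Perm.sign_swap hne]

lemma altSum_mul_swap (τ : Equiv.Perm (Fin k) → V) {i : ℕ} {x x' : Fin k} (hne : x ≠ x')
    (hx : (x : ℕ) < i) (hx' : (x' : ℕ) < i) (y : Equiv.Perm (Fin k)) :
    altSum τ i (y * Equiv.swap x x') = -altSum τ i y := by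
  have hs := sum_initialPerms_swap
    (fun σ => τ (y * Equiv.swap x x' * σ * Equiv.swap x x')) hne hx hx'
  unfold altSum
  rw [← Finset.sum_neg_distrib]
  refine Finset.sum_nbij' (fun σ => Equiv.swap x x' * σ) (fun σ => Equiv.swap x x' * σ)
    ?_ ?_ ?_ ?_ ?_
  · exact fun σ hσ => mul_mem_initialPerms (swap_mem_initialPerms hx hx') hσ
  · exact fun σ hσ => mul_mem_initialPerms (swap_mem_initialPerms hx hx') hσ
  · intro σ _; simp
  · intro σ _; simp
  · intro σ _; simp [Equiv.Perm.sign_swap hne, mul_assoc]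

/-- The identity satisfied by `σ ↦ str (P_σ M₁ ⋯ M_k)` for a Manin matrix `M`. -/
def ManinTrace (τ : Equiv.Perm (Fin k) → V) : Prop :=
  ∀ x x' : Fin k, (x : ℕ) + 1 = x' → ∀ y, τ y + τ (Equiv.swap x x' * y)
    = τ (y * Equiv.swap x x') + τ (Equiv.swap x x' * y * Equiv.swap x x')

lemma ManinTrace.altSum_swap_mul {τ : Equiv.Perm (Fin k) → V} (hτ : ManinTrace τ) {i : ℕ}
    {x x' : Fin k} (hxx : (x : ℕ) + 1 = x') (hx' : (x' : ℕ) < i) (y : Equiv.Perm (Fin k)) :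
    altSum τ i (Equiv.swap x x' * y) = -altSum τ i y := by
  have hne : x ≠ x' := by rintro rfl; omega
  have hx : (x : ℕ) < i := by omega
  have h1 := sum_initialPerms_swap (fun σ => τ (y * σ)) hne hx hx'
  have h2 := sum_initialPerms_swap (fun σ => τ (Equiv.swap x x' * y * σ)) hne hx hx'
  have h : altSum τ i y + altSum τ i (Equiv.swap x x' * y)
      = -altSum τ i y + -altSum τ i (Equiv.swap x x' * y) := by
    rw [altSum, altSum, ← h1, ← h2, ← Finset.sum_add_distrib, ← Finset.sum_add_distrib]
    refine Finset.sum_congr rfl fun σ _ => ?_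
    rw [← smul_add, ← smul_add]
    congr 1
    simpa only [mul_assoc] using hτ x x' hxx (y * σ)
  have h3 : (2 : ℂ) • (altSum τ i y + altSum τ i (Equiv.swap x x' * y)) = 0 := by
    rw [two_smul]
    nth_rewrite 1 [h]
    abel
  rw [smul_eq_zero_iff_right two_ne_zero] at h3
  exact eq_neg_of_add_eq_zero_right h3

/-- Splitting `initialPerms k (i + 1)` into left cosets of `initialPerms k i`. -/
lemma altSum_succ (τ : Equiv.Perm (Fin k) → V) (x : Fin k) (y : Equiv.Perm (Fin k)) :
    altSum τ ((x : ℕ) + 1) y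
      = altSum τ x y - ∑ j ∈ Finset.univ.filter (· < x), altSum τ x (y * Equiv.swap j x) := by
  have key : altSum τ ((x : ℕ) + 1) y = ∑ j ∈ Finset.univ.filter (· ≤ x),
      ∑ σ ∈ initialPerms k x, ((Equiv.Perm.sign (Equiv.swap j x * σ) : ℤ) : ℂ) •
        τ (y * (Equiv.swap j x * σ)) := by
    rw [← Finset.sum_product', altSum]
    refine Finset.sum_nbij' (fun σ => (σ x, Equiv.swap (σ x) x * σ))
      (fun p => Equiv.swap p.1 x * p.2) ?_ ?_ ?_ ?_ ?_
    · intro σ hσ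
      rw [mem_initialPerms] at hσ
      have hle : σ x ≤ x := by
        by_contra hlt
        rw [not_le, Fin.lt_def] at hlt
        have := σ.injective (hσ (σ x) hlt)
        rw [this] at hlt
        exact lt_irrefl _ hlt
      simp only [Finset.mem_product, Finset.mem_filter, Finset.mem_univ, true_and,
        mem_initialPerms, Equiv.Perm.mul_apply]
      refine ⟨hle, fun t ht => ?_⟩
      rcases ht.eq_or_lt with h | h
      · obtain rfl : x = t := Fin.ext h
        simp
      · rw [hσ t h]
        apply Equiv.swap_apply_of_ne_of_ne <;> rintro rfl
        · exact absurd (Fin.le_def.1 hle) (by omega)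
        · omega
    · rintro ⟨j, σ⟩ hp
      simp only [Finset.mem_product, Finset.mem_filter, Finset.mem_univ, true_and,
        mem_initialPerms] at hp ⊢
      intro t ht
      rw [Equiv.Perm.mul_apply, hp.2 t (by omega)]
      have := Fin.le_def.1 hp.1
      apply Equiv.swap_apply_of_ne_of_ne <;> rintro rfl <;> omega
    · intro σ _; simp
    · rintro ⟨j, σ⟩ hp
      simp only [Finset.mem_product, Finset.mem_filter, Finset.mem_univ, true_and,
        mem_initialPerms] at hp
      simp [hp.2 x le_rfl]
    · intro σ _; simp
  have hins : (Finset.univ.filter (· ≤ x)) = insert x (Finset.univ.filter (· < x)) := by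
    ext t; simp [le_iff_eq_or_lt]
  rw [key, hins, Finset.sum_insert (by simp), sub_eq_add_neg, ← Finset.sum_neg_distrib]
  congr 1
  · have h1 : Equiv.swap x x = 1 := Equiv.swap_self x
    simp only [h1, altSum, one_mul]
  · refine Finset.sum_congr rfl fun j hj => ?_
    rw [altSum, ← Finset.sum_neg_distrib]
    refine Finset.sum_congr rfl fun σ _ => ?_
    have hne : j ≠ x := (Finset.mem_filter.1 hj).2.ne
    simp [Equiv.Perm.sign_swap hne, mul_assoc]

/-- The cycle `i ↦ k - 1`, `t ↦ t - 1` for `t > i`, fixing all positions below `i`. -/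
def tailCycle (k i : ℕ) : Equiv.Perm (Fin k) :=
  if h : i < k then
    { toFun := fun t => ⟨if (t : ℕ) < i then t else if (t : ℕ) = i then k - 1 else t - 1, by
        have := t.isLt; split_ifs <;> omega⟩
      invFun := fun t => ⟨if (t : ℕ) < i then t else if (t : ℕ) + 1 = k then i else t + 1, by
        have := t.isLt; split_ifs <;> omega⟩
      left_inv := fun t => by
        have := t.isLt
        ext; simp only
        split_ifs <;> omega
      right_inv := fun t => by
        have := t.isLt
        ext; simp only
        split_ifs <;> omega }
  else 1

lemma tailCycle_apply {i : ℕ} (h : i < k) (t : Fin k) : (tailCycle k i t : ℕ)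
    = if (t : ℕ) < i then (t : ℕ) else if (t : ℕ) = i then k - 1 else t - 1 := by
  simp [tailCycle, h]

lemma tailCycle_mul_swap {x x' : Fin k} (hxx : (x : ℕ) + 1 = x') :
    tailCycle k x' * Equiv.swap x x' = tailCycle k x := by
  ext t
  rw [Equiv.Perm.mul_apply, tailCycle_apply x'.isLt, tailCycle_apply x.isLt, Equiv.swap_apply_def]
  have := x'.isLt
  split_ifs <;> simp_all [Fin.ext_iff] <;> omega

lemma tailCycle_last (K : ℕ) : tailCycle (K + 1) K = 1 := by
  ext t
  rw [tailCycle_apply (Nat.lt_succ_self K)]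
  have := t.isLt
  simp only [Equiv.Perm.coe_one, id_eq]
  split_ifs <;> omega

lemma tailCycle_mul_swap_comm {i : ℕ} (h : i < k) {x x' : Fin k} (hx : (x : ℕ) < i)
    (hx' : (x' : ℕ) < i) :
    tailCycle k i * Equiv.swap x x' = Equiv.swap x x' * tailCycle k i := by
  have e : ∀ t : Fin k, (t : ℕ) < i → tailCycle k i t = t := fun t ht => by
    ext; simp [tailCycle_apply h, ht]
  rw [Equiv.mul_swap_eq_swap_mul, e x hx, e x' hx']

lemma ManinTrace.altSum_tailCycle_swap {τ : Equiv.Perm (Fin k) → V} (hτ : ManinTrace τ)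
    {x x' : Fin k} (hxx : (x : ℕ) + 1 = x') (d : ℕ) (j : Fin k) (hj : (j : ℕ) + d = x) :
    altSum τ x' (tailCycle k x' * Equiv.swap j x') = altSum τ x' (tailCycle k x) := by
  induction d generalizing j with
  | zero =>
    obtain rfl : j = x := Fin.ext (by omega)
    rw [tailCycle_mul_swap hxx]
  | succ d ih =>
    obtain ⟨j', hj'⟩ : ∃ j' : Fin k, (j : ℕ) + 1 = j' := ⟨⟨j + 1, by omega⟩, rfl⟩
    have hne : j ≠ j' := by rintro rfl; omega
    have hne' : j ≠ x' := by rintro rfl; omega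
    have hconj : Equiv.swap j x' = Equiv.swap j j' * Equiv.swap j' x' * Equiv.swap j j' := by
      have h := Equiv.swap_apply_apply (Equiv.swap j j') j' x'
      rw [Equiv.swap_apply_right, Equiv.swap_apply_of_ne_of_ne hne'.symm
        (by rintro rfl; omega), Equiv.swap_inv] at h
      exact h
    rw [hconj, ← mul_assoc, altSum_mul_swap τ hne (by omega) (by omega), ← mul_assoc,
      tailCycle_mul_swap_comm x'.isLt (by omega) (by omega), mul_assoc,
      hτ.altSum_swap_mul hj' (by omega), neg_neg, ih j' (by omega)]

lemma ManinTrace.altSum_tailCycle {τ : Equiv.Perm (Fin k) → V} (hτ : ManinTrace τ) (i : ℕ)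
    (hi : i < k) :
    ((i.factorial : ℂ)⁻¹) • altSum τ (i + 1) (tailCycle k i)
      = ∑ l ∈ Finset.range (i + 1), (-1 : ℂ) ^ (i + l) •
          ((l.factorial : ℂ)⁻¹ • altSum τ l (tailCycle k l)) := by
  induction i with
  | zero =>
    have hempty : (Finset.univ.filter (· < (⟨0, hi⟩ : Fin k))) = ∅ := by
      ext j; simp [Fin.lt_def]
    have h := altSum_succ τ ⟨0, hi⟩ (tailCycle k 0)
    rw [hempty, Finset.sum_empty, sub_zero] at h
    simpa using h
  | succ i ih =>
    have hsplit := altSum_succ τ ⟨i + 1, hi⟩ (tailCycle k (i + 1))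
    have hterm : ∀ j ∈ Finset.univ.filter (· < (⟨i + 1, hi⟩ : Fin k)),
        altSum τ (i + 1) (tailCycle k (i + 1) * Equiv.swap j ⟨i + 1, hi⟩)
          = altSum τ (i + 1) (tailCycle k i) := fun j hj => by
      have hj' : (j : ℕ) < i + 1 := Fin.lt_def.1 (Finset.mem_filter.1 hj).2
      exact hτ.altSum_tailCycle_swap (x := ⟨i, by omega⟩) (x' := ⟨i + 1, hi⟩) rfl (i - j) j
        (by simp only; omega)
    simp only at hsplit
    rw [Finset.sum_congr rfl hterm, Finset.sum_const] at hsplit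
    have hcard : (Finset.univ.filter (· < (⟨i + 1, hi⟩ : Fin k))).card = i + 1 := by
      have : (Finset.univ.filter (· < (⟨i + 1, hi⟩ : Fin k))) = Finset.Iio ⟨i + 1, hi⟩ := by
        ext; simp
      rw [this, Fin.card_Iio]
    rw [hcard] at hsplit
    rw [hsplit, Finset.sum_range_succ, smul_sub, sub_eq_neg_add]
    congr 1
    · have hf : ((i + 1).factorial : ℂ)⁻¹ * ((i + 1 : ℕ) : ℂ) = (i.factorial : ℂ)⁻¹ := by
        rw [Nat.factorial_succ, Nat.cast_mul, mul_inv, mul_comm, ← mul_assoc,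
          mul_inv_cancel₀ (Nat.cast_ne_zero.2 i.succ_ne_zero), one_mul]
      rw [← Nat.cast_smul_eq_nsmul ℂ, smul_smul, hf, ih (by omega), ← Finset.sum_neg_distrib]
      refine Finset.sum_congr rfl fun l _ => ?_
      rw [← neg_smul, add_right_comm, pow_succ, mul_neg_one]
    · rw [← two_mul, pow_mul]
      simp

end Antisymmetrize

/-! ### Explicit entries of `M₁ ⋯ M_k` -/

section Entries

variable {N k : ℕ}

/-- The exponent of the sign in front of `M_{f₁g₁} ⋯ M_{f_kg_k}` in `M₁ ⋯ M_k`. -/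
def signExp (m : ℕ) (f g : Fin k → Fin N) : ℕ :=
  ∑ a, (pa m (f a) * pa m (g a) + pa m (g a)
    + (pa m (f a) + pa m (g a)) * ∑ b ∈ Finset.univ.filter (fun b => b < a), pa m (g b))

/-- The monomial `M_{f₁g₁} ⋯ M_{f_kg_k}`. -/
def wordProd (M : Matrix (Fin N) (Fin N) B) (f g : Fin k → Fin N) : B :=
  (List.ofFn fun a => M (f a) (g a)).prod

lemma prod_map_smul_eq {ι : Type*} (c : ι → ℂ) (x : ι → B) (l : List ι) :
    (l.map fun a => c a • x a).prod = (l.map c).prod • (l.map x).prod := by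
  induction l with
  | nil => simp
  | cons a l ih => simp only [List.map_cons, List.prod_cons, ih, smul_mul_smul_comm]

lemma prod_map_Mslot_apply (m : ℕ) (M : Matrix (Fin N) (Fin N) B) (l : List (Fin k))
    (hl : l.Pairwise (· < ·)) (f g : Fin k → Fin N) :
    (l.map fun a => Mslot m M a).prod f g = if ∀ b, b ∉ l → f b = g b then
      (l.map fun a => ((-1 : ℂ) ^ (pa m (f a) * pa m (g a) + pa m (g a)
          + (pa m (f a) + pa m (g a)) *
              ∑ b ∈ Finset.univ.filter (fun b => b < a), pa m (g b))) • M (f a) (g a)).prod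
      else 0 := by
  induction l generalizing f with
  | nil => simp [Matrix.one_apply, funext_iff]
  | cons a l ih =>
    obtain ⟨ha, hl⟩ := List.pairwise_cons.1 hl
    have hal : a ∉ l := fun h => lt_irrefl _ (ha a h)
    rw [List.map_cons, List.prod_cons, Matrix.mul_apply,
      Finset.sum_eq_single (Function.update f a (g a))]
    · rw [ih hl]
      have hiff : (∀ b, b ∉ l → Function.update f a (g a) b = g b)
          ↔ ∀ b, b ∉ a :: l → f b = g b := by
        refine forall_congr' fun b => ?_
        by_cases hb : b = a
        · subst hb; simp
        · simp [hb]
      simp only [hiff]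
      split_ifs with h
      · rw [List.map_cons, List.prod_cons]
        congr 1
        · have hs : ∑ b ∈ Finset.univ.filter (fun b => b < a), pa m (Function.update f a (g a) b)
              = ∑ b ∈ Finset.univ.filter (fun b => b < a), pa m (g b) := by
            refine Finset.sum_congr rfl fun b hb => ?_
            have hb := (Finset.mem_filter.1 hb).2
            rw [Function.update_of_ne hb.ne, h b]
            rw [List.mem_cons, not_or]
            exact ⟨hb.ne, fun hbl => lt_asymm hb (ha b hbl)⟩
          rw [Mslot, Matrix.of_apply, if_pos, hs, Function.update_self]
          intro b hb
          rw [Function.update_of_ne hb]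
        · refine congrArg _ (List.map_congr_left fun b hb => ?_)
          rw [Function.update_of_ne (ha b hb).ne']
      · rw [mul_zero]
    · intro h _ hne
      by_cases h1 : ∀ b, b ≠ a → f b = h b
      · rw [ih hl, if_neg, mul_zero]
        intro h2
        apply hne
        funext b
        by_cases hb : b = a
        · subst hb; rw [Function.update_self, h2 b hal]
        · rw [Function.update_of_ne hb, h1 b hb]
      · rw [Mslot, Matrix.of_apply, if_neg h1, zero_mul]
    · intro h; exact absurd (Finset.mem_univ _) h

lemma MProd_apply (m : ℕ) (M : Matrix (Fin N) (Fin N) B) (f g : Fin k → Fin N) :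
    MProd m M k f g = (-1 : ℂ) ^ signExp m f g • wordProd M f g := by
  rw [MProd, List.ofFn_eq_map, prod_map_Mslot_apply m M _ (List.pairwise_lt_finRange k),
    if_pos (fun b hb => absurd (List.mem_finRange b) hb), prod_map_smul_eq, wordProd,
    List.ofFn_eq_map, signExp, ← Finset.prod_pow_eq_pow_sum, ← List.ofFn_eq_map,
    List.prod_ofFn]

lemma neg_one_pow_congr_zmod {a b : ℕ} (h : (a : ZMod 2) = b) : (-1 : ℂ) ^ a = (-1) ^ b := by
  rw [ZMod.natCast_eq_natCast_iff'] at h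
  rw [neg_one_pow_eq_pow_mod_two, h, ← neg_one_pow_eq_pow_mod_two]

/-- The total parity of a multi-index. -/
def totalPa (m : ℕ) (f : Fin k → Fin N) : ℕ := ∑ a, pa m (f a)

variable {i j : ℕ}

lemma signExp_append (m : ℕ) (f₁ g₁ : Fin i → Fin N) (f₂ g₂ : Fin j → Fin N) :
    signExp m (Fin.append f₁ f₂) (Fin.append g₁ g₂)
      = signExp m f₁ g₁ + signExp m f₂ g₂
        + (totalPa m f₂ + totalPa m g₂) * totalPa m g₁ := by
  have hl (a b : Fin i) : Fin.castAdd j a < Fin.castAdd j b ↔ a < b := Iff.rfl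
  have hr (a b : Fin j) : Fin.natAdd i a < Fin.natAdd i b ↔ a < b := by
    rw [Fin.lt_def, Fin.lt_def, Fin.val_natAdd, Fin.val_natAdd, Nat.add_lt_add_iff_left]
  have hlr (a : Fin i) (b : Fin j) : Fin.castAdd j a < Fin.natAdd i b := by
    rw [Fin.lt_def, Fin.val_castAdd, Fin.val_natAdd]; omega
  have hrl (a : Fin i) (b : Fin j) : ¬Fin.natAdd i b < Fin.castAdd j a := not_lt_of_gt (hlr a b)
  simp only [signExp, totalPa, Fin.sum_univ_add, Finset.sum_filter, Fin.append_left,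
    Fin.append_right, hl, hr, hlr, hrl, if_true, if_false, Finset.sum_const_zero, mul_zero,
    Finset.sum_add_distrib, mul_add, add_mul, Finset.sum_mul]
  ring

lemma wordProd_append {R : Type*} [Ring R] (M : Matrix (Fin N) (Fin N) R) (f₁ g₁ : Fin i → Fin N)
    (f₂ g₂ : Fin j → Fin N) :
    wordProd M (Fin.append f₁ f₂) (Fin.append g₁ g₂) = wordProd M f₁ g₁ * wordProd M f₂ g₂ := by
  rw [wordProd, List.ofFn_add, List.prod_append]
  simp [wordProd]

lemma totalPa_append (m : ℕ) (f₁ : Fin i → Fin N) (f₂ : Fin j → Fin N) :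
    totalPa m (Fin.append f₁ f₂) = totalPa m f₁ + totalPa m f₂ := by
  simp [totalPa, Fin.sum_univ_add]

lemma totalPa_comp (m : ℕ) (f : Fin k → Fin N) (σ : Equiv.Perm (Fin k)) :
    totalPa m (f ∘ σ) = totalPa m f :=
  Equiv.sum_comp σ fun a => pa m (f a)

end Entries

/-! ### The operators `P_σ` -/

section Pperm

variable {N k : ℕ}

/-- The weight picked up by `P_σ` for each inversion. -/
noncomputable def wt (q : ℂ) (m : ℕ) (x y : Fin N) : ℂ :=
  q ^ eps x y * (-1 : ℂ) ^ (pa m x * pa m y)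

lemma wt_mul_wt {q : ℂ} (hq : q ≠ 0) (m : ℕ) (x y : Fin N) : wt q m x y * wt q m y x = 1 := by
  have he : eps y x = -eps x y := by
    unfold eps; split_ifs <;> omega
  rw [wt, wt, he, zpow_neg, mul_comm (pa m y), mul_mul_mul_comm,
    mul_inv_cancel₀ (zpow_ne_zero _ hq), ← pow_add, ← two_mul, pow_mul]
  simp

/-- The scalar by which `P_σ` maps the basis vector `g` to `g ∘ σ⁻¹`. -/
noncomputable def permWt (q : ℂ) (m : ℕ) (σ : Equiv.Perm (Fin k)) (g : Fin k → Fin N) : ℂ :=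
  ∏ p ∈ Finset.univ.filter (fun p : Fin k × Fin k => p.1 < p.2 ∧ σ p.2 < σ p.1),
    wt q m (g p.1) (g p.2)

lemma Pperm_apply (q : ℂ) (m : ℕ) (σ : Equiv.Perm (Fin k)) (f g : Fin k → Fin N) :
    Pperm q m σ f g = if f = g ∘ ⇑σ⁻¹ then permWt q m σ g else 0 := rfl

lemma permWt_eq_prod_lt (q : ℂ) (m : ℕ) (σ : Equiv.Perm (Fin k)) (g : Fin k → Fin N) :
    permWt q m σ g = ∏ p ∈ Finset.univ.filter (fun p : Fin k × Fin k => p.1 < p.2),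
      if σ p.2 < σ p.1 then wt q m (g p.1) (g p.2) else 1 := by
  rw [permWt, ← Finset.filter_filter, Finset.prod_filter]

lemma permWt_mul {q : ℂ} (hq : q ≠ 0) (m : ℕ) (σ τ : Equiv.Perm (Fin k)) (g : Fin k → Fin N) :
    permWt q m (σ * τ) g = permWt q m σ (g ∘ ⇑τ⁻¹) * permWt q m τ g := by
  have hre : permWt q m σ (g ∘ ⇑τ⁻¹)
      = ∏ p ∈ Finset.univ.filter (fun p : Fin k × Fin k => p.1 < p.2),
        if τ p.1 < τ p.2 then (if σ (τ p.2) < σ (τ p.1) then wt q m (g p.1) (g p.2) else 1)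
        else (if σ (τ p.1) < σ (τ p.2) then wt q m (g p.2) (g p.1) else 1) := by
    rw [permWt_eq_prod_lt]
    symm
    refine Finset.prod_nbij'
      (fun p => if τ p.1 < τ p.2 then (τ p.1, τ p.2) else (τ p.2, τ p.1))
      (fun p => if τ⁻¹ p.1 < τ⁻¹ p.2 then (τ⁻¹ p.1, τ⁻¹ p.2) else (τ⁻¹ p.2, τ⁻¹ p.1))
      ?_ ?_ ?_ ?_ ?_
    · rintro ⟨a, b⟩ hp
      simp only [Finset.mem_filter, Finset.mem_univ, true_and] at hp ⊢
      have hne := τ.injective.ne hp.ne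
      split_ifs with h
      · exact h
      · exact lt_of_le_of_ne (not_lt.1 h) hne.symm
    · rintro ⟨a, b⟩ hp
      simp only [Finset.mem_filter, Finset.mem_univ, true_and] at hp ⊢
      have hne := τ⁻¹.injective.ne hp.ne
      split_ifs with h
      · exact h
      · exact lt_of_le_of_ne (not_lt.1 h) hne.symm
    · rintro ⟨a, b⟩ hp
      simp only [Finset.mem_filter, Finset.mem_univ, true_and] at hp ⊢
      split_ifs with h <;> simp_all [not_lt_of_gt]
    · rintro ⟨a, b⟩ hp
      simp only [Finset.mem_filter, Finset.mem_univ, true_and] at hp ⊢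
      split_ifs with h <;> simp_all [not_lt_of_gt]
    · rintro ⟨a, b⟩ hp
      simp only [Finset.mem_filter, Finset.mem_univ, true_and] at hp ⊢
      split_ifs <;> simp_all
  rw [hre, permWt_eq_prod_lt, permWt_eq_prod_lt, ← Finset.prod_mul_distrib]
  refine Finset.prod_congr rfl ?_
  rintro ⟨a, b⟩ hp
  simp only [Finset.mem_filter, Finset.mem_univ, true_and, Equiv.Perm.mul_apply] at hp ⊢
  have hne := τ.injective.ne hp.ne
  have hne' := σ.injective.ne hne
  rcases lt_or_gt_of_ne hne with h | h <;> rcases lt_or_gt_of_ne hne' with h' | h' <;>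
    simp [h, h', not_lt_of_gt, wt_mul_wt hq]

lemma Pperm_mul {q : ℂ} (hq : q ≠ 0) (m : ℕ) (σ τ : Equiv.Perm (Fin k)) :
    (Pperm q m (σ * τ) : Matrix (Fin k → Fin N) _ ℂ) = Pperm q m σ * Pperm q m τ := by
  ext f g
  rw [Matrix.mul_apply, Finset.sum_eq_single (g ∘ ⇑τ⁻¹)]
  · simp only [Pperm_apply, if_true, permWt_mul hq, mul_inv_rev, ite_mul, zero_mul]
    rfl
  · intro h _ hne
    rw [Pperm_apply q m τ, if_neg hne, mul_zero]
  · intro h; exact absurd (Finset.mem_univ _) h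

lemma cmap_mul {I : Type*} [Fintype I] (X Y : Matrix I I ℂ) :
    (cmap (X * Y) : Matrix I I B) = cmap X * cmap Y :=
  Matrix.map_mul

lemma cmap_smul {I : Type*} (c : ℂ) (X : Matrix I I ℂ) :
    (cmap (c • X) : Matrix I I B) = c • cmap X := by
  ext a b
  rw [Matrix.smul_apply, cmap, cmap, Matrix.map_apply, Matrix.map_apply, Matrix.smul_apply,
    smul_eq_mul, map_mul, Algebra.smul_def]

lemma permWt_one (q : ℂ) (m : ℕ) (g : Fin k → Fin N) : permWt q m 1 g = 1 := by
  rw [permWt_eq_prod_lt]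
  refine Finset.prod_eq_one fun p hp => if_neg ?_
  exact not_lt_of_gt (Finset.mem_filter.1 hp).2

lemma Pperm_one (q : ℂ) (m : ℕ) :
    (Pperm q m 1 : Matrix (Fin k → Fin N) (Fin k → Fin N) ℂ) = 1 := by
  ext f g
  rw [Pperm_apply, permWt_one, Matrix.one_apply]
  rfl

lemma permWt_swap (q : ℂ) (m : ℕ) {x x' : Fin k} (hxx : (x : ℕ) + 1 = x') (g : Fin k → Fin N) :
    permWt q m (Equiv.swap x x') g = wt q m (g x) (g x') := by
  have h : Finset.univ.filter (fun p : Fin k × Fin k =>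
      p.1 < p.2 ∧ Equiv.swap x x' p.2 < Equiv.swap x x' p.1) = {(x, x')} := by
    ext ⟨a, b⟩
    simp only [Finset.mem_filter, Finset.mem_univ, true_and, Finset.mem_singleton, Prod.mk.injEq,
      Equiv.swap_apply_def, Fin.lt_def, Fin.ext_iff]
    constructor
    · rintro ⟨h1, h2⟩
      split_ifs at h2 <;> omega
    · rintro ⟨h1, h2⟩
      split_ifs <;> omega
  rw [permWt, h, Finset.prod_singleton]

lemma cmap_Pperm_mul_apply (q : ℂ) (m : ℕ) (σ : Equiv.Perm (Fin k))
    (X : Matrix (Fin k → Fin N) (Fin k → Fin N) B) (f g : Fin k → Fin N) :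
    (cmap (Pperm q m σ) * X : Matrix _ _ B) f g = permWt q m σ (f ∘ σ) • X (f ∘ σ) g := by
  rw [Matrix.mul_apply, Finset.sum_eq_single (f ∘ σ)]
  · have h : f = (f ∘ σ) ∘ ⇑σ⁻¹ := by ext; simp
    rw [cmap, Matrix.map_apply, Pperm_apply, if_pos h, Algebra.smul_def]
  · intro h _ hne
    rw [cmap, Matrix.map_apply, Pperm_apply, if_neg, map_zero, zero_mul]
    rintro rfl
    apply hne
    ext; simp
  · intro h; exact absurd (Finset.mem_univ _) h

lemma mul_cmap_Pperm_apply (q : ℂ) (m : ℕ) (σ : Equiv.Perm (Fin k))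
    (X : Matrix (Fin k → Fin N) (Fin k → Fin N) B) (f g : Fin k → Fin N) :
    (X * cmap (Pperm q m σ) : Matrix _ _ B) f g = permWt q m σ g • X f (g ∘ ⇑σ⁻¹) := by
  rw [Matrix.mul_apply, Finset.sum_eq_single (g ∘ ⇑σ⁻¹)]
  · rw [cmap, Matrix.map_apply, Pperm_apply, if_pos rfl, ← Algebra.commutes, Algebra.smul_def]
  · intro h _ hne
    rw [cmap, Matrix.map_apply, Pperm_apply, if_neg hne, map_zero, mul_zero]
  · intro h; exact absurd (Finset.mem_univ _) h

end Pperm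

/-! ### Block permutations -/

section Blocks

variable {N i j : ℕ}

/-- The permutation of `Fin (i + j)` acting by `α` on the first block and by `β` on the second. -/
def blockPerm (α : Equiv.Perm (Fin i)) (β : Equiv.Perm (Fin j)) : Equiv.Perm (Fin (i + j)) :=
  finSumFinEquiv.permCongr (Equiv.Perm.sumCongr α β)

@[simp]
lemma blockPerm_castAdd (α : Equiv.Perm (Fin i)) (β : Equiv.Perm (Fin j)) (t : Fin i) :
    blockPerm α β (Fin.castAdd j t) = Fin.castAdd j (α t) := by
  simp [blockPerm, Equiv.permCongr_apply]

@[simp]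
lemma blockPerm_natAdd (α : Equiv.Perm (Fin i)) (β : Equiv.Perm (Fin j)) (t : Fin j) :
    blockPerm α β (Fin.natAdd i t) = Fin.natAdd i (β t) := by
  simp [blockPerm, Equiv.permCongr_apply]

lemma blockPerm_inv (α : Equiv.Perm (Fin i)) (β : Equiv.Perm (Fin j)) :
    (blockPerm α β)⁻¹ = blockPerm α⁻¹ β⁻¹ := by
  rw [inv_eq_iff_mul_eq_one]
  ext t
  refine Fin.addCases (fun t => ?_) (fun t => ?_) t <;> simp

lemma sign_blockPerm (α : Equiv.Perm (Fin i)) (β : Equiv.Perm (Fin j)) :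
    Equiv.Perm.sign (blockPerm α β) = Equiv.Perm.sign α * Equiv.Perm.sign β := by
  rw [blockPerm, Equiv.Perm.sign_permCongr, Equiv.Perm.sign_sumCongr]

lemma append_comp_blockPerm (α : Equiv.Perm (Fin i)) (β : Equiv.Perm (Fin j))
    (f₁ : Fin i → Fin N) (f₂ : Fin j → Fin N) :
    Fin.append f₁ f₂ ∘ blockPerm α β = Fin.append (f₁ ∘ α) (f₂ ∘ β) := by
  ext t
  refine Fin.addCases (fun t => ?_) (fun t => ?_) t <;> simp

lemma permWt_eq_prod_prod {k : ℕ} (q : ℂ) (m : ℕ) (σ : Equiv.Perm (Fin k)) (g : Fin k → Fin N) :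
    permWt q m σ g = ∏ a, ∏ b, if a < b ∧ σ b < σ a then wt q m (g a) (g b) else 1 := by
  rw [permWt, Finset.prod_filter, Fintype.prod_prod_type]

lemma permWt_blockPerm (q : ℂ) (m : ℕ) (α : Equiv.Perm (Fin i)) (β : Equiv.Perm (Fin j))
    (g₁ : Fin i → Fin N) (g₂ : Fin j → Fin N) :
    permWt q m (blockPerm α β) (Fin.append g₁ g₂) = permWt q m α g₁ * permWt q m β g₂ := by
  have hl (a b : Fin i) : Fin.castAdd j a < Fin.castAdd j b ↔ a < b := Iff.rfl
  have hr (a b : Fin j) : Fin.natAdd i a < Fin.natAdd i b ↔ a < b := by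
    rw [Fin.lt_def, Fin.lt_def, Fin.val_natAdd, Fin.val_natAdd, Nat.add_lt_add_iff_left]
  have hrl (a : Fin i) (b : Fin j) : ¬Fin.natAdd i b < Fin.castAdd j a := by
    rw [Fin.lt_def, Fin.val_castAdd, Fin.val_natAdd]; omega
  simp only [permWt_eq_prod_prod, Fin.prod_univ_add, blockPerm_castAdd, blockPerm_natAdd,
    Fin.append_left, Fin.append_right, hl, hr, hrl, and_false, false_and, if_false,
    Finset.prod_const_one, one_mul, mul_one]

lemma MProd_append (m : ℕ) (M : Matrix (Fin N) (Fin N) B) (f₁ g₁ : Fin i → Fin N)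
    (f₂ g₂ : Fin j → Fin N) :
    MProd m M (i + j) (Fin.append f₁ f₂) (Fin.append g₁ g₂)
      = (-1 : ℂ) ^ ((totalPa m f₂ + totalPa m g₂) * totalPa m g₁) •
        (MProd m M i f₁ g₁ * MProd m M j f₂ g₂) := by
  rw [MProd_apply, MProd_apply, MProd_apply, signExp_append, wordProd_append,
    smul_mul_smul_comm, smul_smul, pow_add, pow_add]
  congr 1
  ring

end Blocks

/-! ### The trace function of a Manin matrix -/

section Trace

variable {N k : ℕ}

lemma strAll_mul_comm (q : ℂ) (m : ℕ) (σ : Equiv.Perm (Fin k))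
    (X : Matrix (Fin k → Fin N) (Fin k → Fin N) B) :
    strAll m (X * cmap (Pperm q m σ)) = strAll m (cmap (Pperm q m σ) * X) := by
  simp only [strAll, mul_cmap_Pperm_apply, cmap_Pperm_mul_apply]
  refine Fintype.sum_equiv (Equiv.arrowCongr σ (Equiv.refl (Fin N))) _ _ fun f => ?_
  have h1 : Equiv.arrowCongr σ (Equiv.refl (Fin N)) f = f ∘ ⇑σ⁻¹ := rfl
  have h2 : (f ∘ ⇑σ⁻¹) ∘ ⇑σ = f := by ext; simp
  have h3 := totalPa_comp m f σ⁻¹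
  unfold totalPa at h3
  rw [h1, h2, h3]

/-- The function `σ ↦ str (P_σ M₁ ⋯ M_k)`. -/
noncomputable def permTrace (q : ℂ) (m : ℕ) (M : Matrix (Fin N) (Fin N) B)
    (σ : Equiv.Perm (Fin k)) : B :=
  strAll m (cmap (Pperm q m σ) * MProd m M k)

lemma permTrace_eq (q : ℂ) (m : ℕ) (M : Matrix (Fin N) (Fin N) B) (σ : Equiv.Perm (Fin k)) :
    permTrace q m M σ = ∑ f : Fin k → Fin N,
      (-1 : ℂ) ^ totalPa m f • permWt q m σ f • MProd m M k f (f ∘ ⇑σ⁻¹) := by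
  rw [permTrace, ← strAll_mul_comm]
  simp only [strAll, mul_cmap_Pperm_apply, totalPa]

lemma permTrace_blockPerm {i j : ℕ} (q : ℂ) (m : ℕ) (M : Matrix (Fin N) (Fin N) B)
    (α : Equiv.Perm (Fin i)) (β : Equiv.Perm (Fin j)) :
    permTrace q m M (blockPerm α β) = permTrace q m M α * permTrace q m M β := by
  rw [permTrace_eq, permTrace_eq, permTrace_eq, Finset.sum_mul_sum, ← Finset.sum_product',
    Finset.univ_product_univ]
  refine (Fintype.sum_equiv (Fin.appendEquiv i j) _ _ ?_).symm
  rintro ⟨f₁, f₂⟩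
  have h : Fin.appendEquiv i j (f₁, f₂) = Fin.append f₁ f₂ := rfl
  rw [h, blockPerm_inv, append_comp_blockPerm, permWt_blockPerm, MProd_append, totalPa_append,
    totalPa_comp m f₂, ← two_mul, mul_assoc, pow_mul]
  simp only [smul_mul_smul_comm, smul_smul, even_two, Even.neg_pow, one_pow, mul_one, pow_add]
  congr 1
  ring

lemma sandwich_apply (q : ℂ) (m : ℕ) (X : Matrix (Fin k → Fin N) (Fin k → Fin N) B)
    (s : Equiv.Perm (Fin k)) (f g : Fin k → Fin N) :
    ((1 - cmap (Pperm q m s)) * X * (1 + cmap (Pperm q m s)) : Matrix _ _ B) f g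
      = X f g - permWt q m s (f ∘ s) • X (f ∘ s) g
        + permWt q m s g • (X f (g ∘ ⇑s⁻¹) - permWt q m s (f ∘ s) • X (f ∘ s) (g ∘ ⇑s⁻¹)) := by
  rw [mul_add, mul_one, Matrix.add_apply, mul_cmap_Pperm_apply, sub_mul, one_mul,
    Matrix.sub_apply, Matrix.sub_apply, cmap_Pperm_mul_apply, cmap_Pperm_mul_apply]

lemma permTrace_maninTrace {q : ℂ} (hq : q ≠ 0) (m : ℕ) (M : Matrix (Fin N) (Fin N) B)
    (h : ∀ x x' : Fin k, (x : ℕ) + 1 = x' → (1 - cmap (Pperm q m (Equiv.swap x x'))) *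
      MProd m M k * (1 + cmap (Pperm q m (Equiv.swap x x'))) = 0) :
    ManinTrace (permTrace q m M : Equiv.Perm (Fin k) → B) := by
  intro x x' hxx y
  have hadd (X Y : Matrix (Fin k → Fin N) (Fin k → Fin N) B) :
      strAll m (X + Y) = strAll m X + strAll m Y := by
    simp [strAll, Finset.sum_add_distrib]
  have hsub (X Y : Matrix (Fin k → Fin N) (Fin k → Fin N) B) :
      strAll m (X - Y) = strAll m X - strAll m Y := by
    simp [strAll, smul_sub]
  have h0 := congrArg (fun X => strAll m (cmap (Pperm q m y) * X)) (h x x' hxx)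
  have hz : strAll m (0 : Matrix (Fin k → Fin N) (Fin k → Fin N) B) = 0 := by simp [strAll]
  simp only [mul_zero, hz] at h0
  rw [mul_add, mul_one, sub_mul, one_mul, mul_add, hadd, ← mul_assoc, strAll_mul_comm, ← hadd,
    mul_sub, mul_sub, hadd, hsub, hsub] at h0
  simp only [← mul_assoc, ← cmap_mul, ← Pperm_mul hq] at h0
  simp only [permTrace]
  rw [← sub_eq_zero, ← h0]
  abel

lemma manin_pair {q : ℂ} {m : ℕ} {M : Matrix (Fin N) (Fin N) B} (hM : IsManin2 q m M) :
    (1 - cmap (Pperm q m (Equiv.swap (0 : Fin 2) 1))) * MProd m M 2 *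
      (1 + cmap (Pperm q m (Equiv.swap (0 : Fin 2) 1))) = 0 := by
  have hne : (1 : Equiv.Perm (Fin 2)) ≠ Equiv.swap 0 1 := by decide
  have huniv : (Finset.univ.filter fun σ : Equiv.Perm (Fin 2) =>
      ∀ t ∉ (Finset.univ : Finset (Fin 2)), σ t = t) = {1, Equiv.swap 0 1} := by
    rw [Finset.filter_true_of_mem (by simp)]
    decide
  have hA : (cmap (AqS q m (Finset.univ : Finset (Fin 2))) :
      Matrix (Fin 2 → Fin N) (Fin 2 → Fin N) B)
      = (2 : ℂ)⁻¹ • (1 - cmap (Pperm q m (Equiv.swap (0 : Fin 2) 1))) := by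
    rw [AqS, huniv, Finset.sum_pair hne, cmap_smul, Pperm_one, Equiv.Perm.sign_swap (by decide)]
    congr 1
    ext f g
    by_cases hfg : f = g <;> simp [cmap, hfg, sub_eq_add_neg]
  have hH : (cmap (HqS q m (Finset.univ : Finset (Fin 2))) :
      Matrix (Fin 2 → Fin N) (Fin 2 → Fin N) B)
      = (2 : ℂ)⁻¹ • (1 + cmap (Pperm q m (Equiv.swap (0 : Fin 2) 1))) := by
    rw [HqS, huniv, Finset.sum_pair hne, cmap_smul, Pperm_one]
    congr 1
    ext f g
    by_cases hfg : f = g <;> simp [cmap, hfg]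
  have hP : MProd m M 2 = Mslot m M (0 : Fin 2) * Mslot m M (1 : Fin 2) := by
    simp [MProd, List.ofFn_succ]
  have h := hM
  rw [IsManin2, hA, hH, mul_assoc (_ • _), ← hP, smul_mul_assoc, smul_mul_smul_comm] at h
  exact (smul_eq_zero_iff_right (by norm_num)).1 h

lemma manin_block {q : ℂ} {m : ℕ} {M : Matrix (Fin N) (Fin N) B} (hM : IsManin2 q m M)
    (a b : ℕ) :
    (1 - cmap (Pperm q m (blockPerm (blockPerm (1 : Equiv.Perm (Fin a))
        (Equiv.swap (0 : Fin 2) 1)) (1 : Equiv.Perm (Fin b))))) * MProd m M (a + 2 + b) *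
      (1 + cmap (Pperm q m (blockPerm (blockPerm 1 (Equiv.swap (0 : Fin 2) 1)) 1))) = 0 := by
  have hsurj {i j : ℕ} (f : Fin (i + j) → Fin N) : ∃ f₁ f₂, f = Fin.append f₁ f₂ :=
    ⟨_, _, (Fin.append_castAdd_natAdd (f := f)).symm⟩
  ext f g
  obtain ⟨f', f₂, rfl⟩ := hsurj f
  obtain ⟨f₁, f₀, rfl⟩ := hsurj f'
  obtain ⟨g', g₂, rfl⟩ := hsurj g
  obtain ⟨g₁, g₀, rfl⟩ := hsurj g'
  have h := congrFun (congrFun (manin_pair hM) f₀) g₀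
  rw [sandwich_apply, Matrix.zero_apply] at h
  rw [sandwich_apply, Matrix.zero_apply]
  simp only [blockPerm_inv, append_comp_blockPerm, permWt_blockPerm, MProd_append, permWt_one,
    inv_one, Equiv.Perm.coe_one, Function.comp_id, totalPa_append, totalPa_comp, one_mul, mul_one]
  generalize MProd m M a f₁ g₁ = u
  generalize MProd m M b f₂ g₂ = v
  generalize (-1 : ℂ) ^ ((totalPa m f₀ + totalPa m g₀) * totalPa m g₁) = c
  generalize (-1 : ℂ) ^ ((totalPa m f₂ + totalPa m g₂) * (totalPa m g₁ + totalPa m g₀)) = d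
  have h' := congrArg
    (d • (LinearMap.mulRight ℂ v).comp (c • LinearMap.mulLeft ℂ u) : B →ₗ[ℂ] B) h
  simp only [map_add, map_sub, map_smul, map_zero] at h'
  exact h'

lemma manin_slots {q : ℂ} {m : ℕ} {M : Matrix (Fin N) (Fin N) B} (hM : IsManin2 q m M)
    (x x' : Fin k) (hxx : (x : ℕ) + 1 = x') :
    (1 - cmap (Pperm q m (Equiv.swap x x'))) * MProd m M k *
      (1 + cmap (Pperm q m (Equiv.swap x x'))) = 0 := by
  obtain ⟨a, ha⟩ : ∃ a : ℕ, a = x := ⟨x, rfl⟩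
  obtain ⟨b, rfl⟩ : ∃ b, k = a + 2 + b := ⟨k - (a + 2), by omega⟩
  have hs : Equiv.swap x x' = blockPerm (blockPerm (1 : Equiv.Perm (Fin a))
      (Equiv.swap (0 : Fin 2) 1)) (1 : Equiv.Perm (Fin b)) := by
    obtain rfl : x = Fin.castAdd b (Fin.natAdd a 0) := Fin.ext (by simp [ha])
    obtain rfl : x' = Fin.castAdd b (Fin.natAdd a 1) := Fin.ext (by simp [← hxx])
    ext t
    refine Fin.addCases (fun t => ?_) (fun t => ?_) t
    · refine Fin.addCases (fun t => ?_) (fun t => ?_) t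
      · rw [Equiv.swap_apply_of_ne_of_ne]
        · simp
        all_goals
          intro h
          have := t.isLt
          simp [Fin.ext_iff] at h
          omega
      · fin_cases t <;> simp
    · rw [Equiv.swap_apply_of_ne_of_ne]
      · simp
      all_goals
        intro h
        simp [Fin.ext_iff] at h
        omega
  rw [hs]
  exact manin_block hM a b

end Trace

/-! ### Powers for the star product -/

section Powers

variable {N : ℕ}

lemma permWt_swap_two (q : ℂ) (m : ℕ) (g : Fin 2 → Fin N) :
    permWt q m (Equiv.swap (0 : Fin 2) 1) g = wt q m (g 0) (g 1) :=
  permWt_swap q m rfl g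

lemma starMul_apply (q : ℂ) (m : ℕ) (X Y : Matrix (Fin N) (Fin N) B) (i l : Fin N) :
    starMul q m X Y i l = ∑ b, (-1 : ℂ) ^ (pa m i * pa m l + pa m b + pa m b * pa m l) •
      wt q m i b • (X i b * Y b l) := by
  rw [starMul, Matrix.of_apply, Finset.smul_sum]
  refine Finset.sum_congr rfl fun b _ => ?_
  have hcomp : (![b, i] : Fin 2 → Fin N) ∘ Equiv.swap (0 : Fin 2) 1 = ![i, b] := by
    ext t; fin_cases t <;> simp
  have hXY : (Mslot m X (0 : Fin 2) * Mslot m Y (1 : Fin 2) : Matrix _ _ B) ![i, b] ![b, l]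
      = (-1 : ℂ) ^ (pa m i * pa m b + pa m b) •
        (-1 : ℂ) ^ (pa m b * pa m l + pa m l + (pa m b + pa m l) * pa m b) •
          (X i b * Y b l) := by
    rw [Matrix.mul_apply, Finset.sum_eq_single ![b, b]]
    · have h0 : (Finset.univ.filter fun t : Fin 2 => t < 0) = ∅ := by decide
      have h1 : (Finset.univ.filter fun t : Fin 2 => t < 1) = {0} := by decide
      rw [Mslot, Mslot, Matrix.of_apply, Matrix.of_apply, if_pos, if_pos, h0, h1]
      · simp [smul_smul, mul_comm]
      · intro t ht; fin_cases t <;> simp_all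
      · intro t ht; fin_cases t <;> simp_all
    · intro h _ hne
      by_cases h1 : h 1 = b
      · have h0 : h 0 ≠ b := by
          rintro h0; apply hne; ext t; fin_cases t <;> simp [h0, h1]
        rw [Mslot, Mslot, Matrix.of_apply, Matrix.of_apply, if_neg (c := ∀ b_1, _ → h b_1 = _),
          mul_zero]
        intro hc
        exact h0 (hc 0 (by decide))
      · rw [Mslot, Matrix.of_apply, if_neg, zero_mul]
        intro hc
        exact h1 (hc 1 (by decide)).symm
    · intro h; exact absurd (Finset.mem_univ _) h
  rw [mul_assoc, cmap_Pperm_mul_apply, hcomp, hXY, permWt_swap_two]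
  simp only [smul_smul, Matrix.cons_val_zero, Matrix.cons_val_one]
  congr 1
  rw [← pow_add, mul_comm (wt q m i b), ← mul_assoc, ← pow_add, ← mul_assoc, ← pow_add]
  congr 1
  apply neg_one_pow_congr_zmod
  push_cast
  generalize (pa m i : ZMod 2) = x
  generalize (pa m b : ZMod 2) = y
  generalize (pa m l : ZMod 2) = z
  decide +revert

/-- The exponent `∑ f̄ₜ ḡₜ`. -/
def pairPa {k : ℕ} (m : ℕ) (f g : Fin k → Fin N) : ℕ := ∑ t, pa m (f t) * pa m (g t)

variable {j : ℕ}

lemma pairPa_snoc (m : ℕ) (f g : Fin j → Fin N) (x y : Fin N) :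
    pairPa m (Fin.snoc f x : Fin (j + 1) → Fin N) (Fin.snoc g y : Fin (j + 1) → Fin N)
      = pairPa m f g + pa m x * pa m y := by
  simp [pairPa, Fin.sum_univ_castSucc]

lemma totalPa_snoc (m : ℕ) (f : Fin j → Fin N) (x : Fin N) :
    totalPa m (Fin.snoc f x : Fin (j + 1) → Fin N) = totalPa m f + pa m x := by
  simp [totalPa, Fin.sum_univ_castSucc]

lemma totalPa_cons (m : ℕ) (f : Fin j → Fin N) (x : Fin N) :
    totalPa m (Fin.cons x f : Fin (j + 1) → Fin N) = pa m x + totalPa m f := by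
  simp [totalPa, Fin.sum_univ_succ]

lemma wordProd_snoc {R : Type*} [Ring R] (M : Matrix (Fin N) (Fin N) R) (f g : Fin j → Fin N)
    (x y : Fin N) :
    wordProd M (Fin.snoc f x : Fin (j + 1) → Fin N) (Fin.snoc g y : Fin (j + 1) → Fin N)
      = wordProd M f g * M x y := by
  rw [wordProd, List.ofFn_succ', List.concat_eq_append, List.prod_append]
  simp [wordProd]

lemma signExp_snoc (m : ℕ) (f g : Fin j → Fin N) (x y : Fin N) :
    signExp m (Fin.snoc f x : Fin (j + 1) → Fin N) (Fin.snoc g y : Fin (j + 1) → Fin N)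
      = signExp m f g + (pa m x * pa m y + pa m y) + (pa m x + pa m y) * totalPa m g := by
  have h (f : Fin j → Fin N) (x : Fin N) :
      (Fin.snoc f x : Fin (j + 1) → Fin N) = Fin.append f ![x] :=
    (Fin.append_right_eq_snoc f ![x]).symm
  rw [h, h, signExp_append]
  simp [signExp, totalPa]

/-- Parity of the sign exponent along a chain of indices. -/
lemma signExp_chain (m : ℕ) (i l : Fin N) (a : Fin j → Fin N) :
    (signExp m (Fin.cons i a : Fin (j + 1) → Fin N) (Fin.snoc a l : Fin (j + 1) → Fin N) : ZMod 2)
      = pairPa m (Fin.cons i a : Fin (j + 1) → Fin N) (Fin.snoc a l : Fin (j + 1) → Fin N)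
        + pa m l + pa m l * totalPa m a := by
  induction j generalizing l with
  | zero => simp [signExp, pairPa, totalPa, Fin.snoc]
  | succ j ih =>
    obtain ⟨a, b, rfl⟩ : ∃ (a' : Fin j → Fin N) (b : Fin N), a = Fin.snoc a' b :=
      ⟨Fin.init a, a (Fin.last j), (Fin.snoc_init_self a).symm⟩
    rw [Fin.cons_snoc_eq_snoc_cons, signExp_snoc, pairPa_snoc, totalPa_snoc]
    push_cast
    rw [ih]
    generalize (pairPa m _ _ : ZMod 2) = p
    generalize (totalPa m a : ZMod 2) = s
    generalize (pa m b : ZMod 2) = y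
    generalize (pa m l : ZMod 2) = z
    decide +revert

lemma Mpow_succ_apply (q : ℂ) (m : ℕ) (M : Matrix (Fin N) (Fin N) B) (j : ℕ) (i l : Fin N) :
    Mpow q m M (j + 1) i l = ∑ a : Fin j → Fin N,
      (-1 : ℂ) ^ (pa m i * pa m l
        + pairPa m (Fin.cons i a : Fin (j + 1) → Fin N) (Fin.snoc a l : Fin (j + 1) → Fin N)
        + totalPa m a + pa m i * totalPa m a) • (∏ t, wt q m i (a t)) •
        wordProd M (Fin.cons i a : Fin (j + 1) → Fin N) (Fin.snoc a l : Fin (j + 1) → Fin N) := by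
  induction j generalizing l with
  | zero =>
    simp [Mpow, pairPa, totalPa, wordProd, Fin.snoc, ← two_mul, pow_mul]
  | succ j ih =>
    rw [Mpow, starMul_apply, ← Fintype.sum_equiv (Fin.snocEquiv fun _ => Fin N) _ _ fun _ => rfl,
      Fintype.sum_prod_type]
    refine Finset.sum_congr rfl fun b _ => ?_
    rw [ih, Finset.sum_mul, Finset.smul_sum, Finset.smul_sum]
    refine Finset.sum_congr rfl fun a _ => ?_
    have hsn : Fin.snocEquiv (fun _ => Fin N) (b, a) = (Fin.snoc a b : Fin (j + 1) → Fin N) := rfl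
    rw [hsn, Fin.cons_snoc_eq_snoc_cons, wordProd_snoc, pairPa_snoc, totalPa_snoc,
      Fin.prod_univ_castSucc]
    simp only [Fin.snoc_castSucc, Fin.snoc_last, smul_mul_assoc, smul_smul]
    congr 1
    rw [mul_comm (wt q m i b), mul_assoc ((-1 : ℂ) ^ _) _ (wt q m i b), ← mul_assoc, ← pow_add]
    congr 1
    apply neg_one_pow_congr_zmod
    push_cast
    generalize (pairPa m _ _ : ZMod 2) = p
    generalize (totalPa m a : ZMod 2) = s
    generalize (pa m i : ZMod 2) = x
    generalize (pa m b : ZMod 2) = y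
    generalize (pa m l : ZMod 2) = z
    decide +revert

lemma permWt_finRotate_inv (q : ℂ) (m : ℕ) (i : Fin N) (a : Fin j → Fin N) :
    permWt q m (finRotate (j + 1))⁻¹ (Fin.cons i a : Fin (j + 1) → Fin N)
      = ∏ t, wt q m i (a t) := by
  have h0 : (finRotate (j + 1))⁻¹ 0 = Fin.last j := by
    rw [Equiv.Perm.inv_eq_iff_eq, finRotate_last]
  have hs (t : Fin j) : (finRotate (j + 1))⁻¹ t.succ = t.castSucc := by
    rw [Equiv.Perm.inv_eq_iff_eq, finRotate_apply, Fin.coeSucc_eq_succ]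
  rw [permWt_eq_prod_prod, Fin.prod_univ_succ, Fin.prod_univ_succ]
  have h1 : ∀ s t : Fin j, ¬(s < t ∧ t < s) := fun s t h => lt_asymm h.1 h.2
  generalize (finRotate (j + 1))⁻¹ = σ at *
  simp [Fin.prod_univ_succ, h0, hs, Fin.castSucc_lt_last, h1]

lemma permTrace_finRotate_inv (q : ℂ) (m : ℕ) (M : Matrix (Fin N) (Fin N) B) (j : ℕ) :
    permTrace q m M (finRotate (j + 1))⁻¹ = strM m (Mpow q m M (j + 1)) := by
  rw [permTrace_eq, ← Fintype.sum_equiv (Fin.consEquiv fun _ => Fin N) _ _ fun _ => rfl,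
    Fintype.sum_prod_type, strM]
  refine Finset.sum_congr rfl fun i _ => ?_
  rw [Mpow_succ_apply, Finset.smul_sum]
  refine Finset.sum_congr rfl fun a _ => ?_
  have hc : Fin.consEquiv (fun _ => Fin N) (i, a) = (Fin.cons i a : Fin (j + 1) → Fin N) := rfl
  have hr : (Fin.cons i a : Fin (j + 1) → Fin N) ∘ ⇑((finRotate (j + 1))⁻¹)⁻¹ = Fin.snoc a i := by
    rw [inv_inv, Fin.snoc_eq_cons_rotate]
    rfl
  rw [hc, hr, permWt_finRotate_inv, MProd_apply, totalPa_cons]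
  simp only [smul_smul]
  congr 1
  rw [mul_comm (∏ t, wt q m i (a t)), ← mul_assoc, ← pow_add, ← mul_assoc, ← pow_add]
  congr 1
  apply neg_one_pow_congr_zmod
  push_cast
  rw [signExp_chain]
  generalize (pairPa m _ _ : ZMod 2) = p
  generalize (totalPa m a : ZMod 2) = s
  generalize (pa m i : ZMod 2) = x
  decide +revert

end Powers

/-! ### The recursion -/

section Recursion

variable {N : ℕ}

lemma strAll_AqS (q : ℂ) (m k : ℕ) (M : Matrix (Fin N) (Fin N) B) :
    strAll m (cmap (AqS q m (Finset.univ : Finset (Fin k))) * MProd m M k)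
      = (k.factorial : ℂ)⁻¹ • ∑ σ : Equiv.Perm (Fin k),
          ((Equiv.Perm.sign σ : ℤ) : ℂ) • permTrace q m M σ := by
  have hsum (s : Finset (Equiv.Perm (Fin k)))
      (F : Equiv.Perm (Fin k) → Matrix (Fin k → Fin N) (Fin k → Fin N) ℂ) :
      (cmap (∑ σ ∈ s, F σ) : Matrix _ _ B) = ∑ σ ∈ s, cmap (F σ) :=
    map_sum (AddMonoidHom.mapMatrix (algebraMap ℂ B).toAddMonoidHom) F s
  have hstr : ∀ X, strAll m X = (∑ f : Fin k → Fin N, ((-1 : ℂ) ^ totalPa m f) •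
      (Matrix.entryLinearMap ℂ B f f : Matrix (Fin k → Fin N) (Fin k → Fin N) B →ₗ[ℂ] B)) X := by
    intro X
    simp [strAll, totalPa, LinearMap.sum_apply]
  rw [AqS, Finset.filter_true_of_mem (by simp), cmap_smul, hsum, Finset.card_univ,
    Fintype.card_fin, smul_mul_assoc, Finset.sum_mul, hstr, map_smul, map_sum]
  congr 1
  refine Finset.sum_congr rfl fun σ _ => ?_
  rw [cmap_smul, smul_mul_assoc, map_smul, permTrace, hstr]

lemma tailCycle_eq_blockPerm (i j : ℕ) :
    tailCycle (i + (j + 1)) i = blockPerm 1 (finRotate (j + 1))⁻¹ := by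
  rw [← inv_inj, blockPerm_inv, inv_inv, inv_one, inv_eq_iff_mul_eq_one]
  ext t
  rw [Equiv.Perm.mul_apply, tailCycle_apply (by omega)]
  refine Fin.addCases (fun t => ?_) (fun t => ?_) t
  · simp
  · refine Fin.lastCases ?_ (fun t => ?_) t
    · rw [blockPerm_natAdd, finRotate_last]
      simp
    · rw [blockPerm_natAdd, finRotate_apply, Fin.coeSucc_eq_succ]
      simp

lemma initialPerms_eq_image (i j : ℕ) :
    initialPerms (i + j) i
      = Finset.univ.image fun α : Equiv.Perm (Fin i) => blockPerm α (1 : Equiv.Perm (Fin j)) := by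
  ext σ
  rw [mem_initialPerms, Finset.mem_image]
  constructor
  · intro hσ
    have hmaps : Set.MapsTo (finSumFinEquiv.symm.permCongr σ) (Set.range Sum.inl)
        (Set.range (Sum.inl : Fin i → Fin i ⊕ Fin j)) := by
      rintro _ ⟨t, rfl⟩
      rw [Equiv.permCongr_apply, Equiv.symm_symm, finSumFinEquiv_apply_left]
      rcases h : finSumFinEquiv.symm (σ (Fin.castAdd j t)) with s | s
      · exact ⟨s, rfl⟩
      · rw [Equiv.symm_apply_eq, finSumFinEquiv_apply_right] at h
        rw [← hσ (Fin.natAdd i s) (by simp)] at h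
        have := Fin.ext_iff.1 (σ.injective h)
        simp at this
        omega
    obtain ⟨⟨α, β⟩, h⟩ := Equiv.Perm.mem_sumCongrHom_range_of_perm_mapsTo_inl hmaps
    have hb : blockPerm α β = σ := by
      rw [Equiv.Perm.sumCongrHom_apply] at h
      rw [blockPerm, h]
      ext t
      simp [Equiv.permCongr_apply]
    obtain rfl : β = 1 := by
      ext t
      have := hσ (Fin.natAdd i t) (by simp)
      rw [← hb, blockPerm_natAdd, Fin.natAdd_inj] at this
      rw [this]
      rfl
    exact ⟨α, Finset.mem_univ _, hb⟩
  · rintro ⟨α, -, rfl⟩ t ht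
    induction t using Fin.addCases with
    | left t => simp at ht; omega
    | right t => simp

lemma altSum_permTrace (q : ℂ) (m : ℕ) (M : Matrix (Fin N) (Fin N) B) {l k : ℕ} (h : l < k) :
    altSum (permTrace q m M : Equiv.Perm (Fin k) → B) l (tailCycle k l)
      = (∑ σ : Equiv.Perm (Fin l), ((Equiv.Perm.sign σ : ℤ) : ℂ) • permTrace q m M σ) *
        strM m (Mpow q m M (k - l)) := by
  obtain ⟨j, rfl⟩ : ∃ j, k = l + (j + 1) := ⟨k - l - 1, by omega⟩
  have hinj : Function.Injective
      fun α : Equiv.Perm (Fin l) => blockPerm α (1 : Equiv.Perm (Fin (j + 1))) := by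
    intro α α' hα
    refine Equiv.ext fun t => ?_
    have := DFunLike.congr_fun hα (Fin.castAdd (j + 1) t)
    simpa using this
  have hmul (α : Equiv.Perm (Fin l)) (β : Equiv.Perm (Fin (j + 1))) :
      blockPerm 1 β * blockPerm α 1 = blockPerm α β := by
    ext t
    refine Fin.addCases (fun t => ?_) (fun t => ?_) t <;> simp
  rw [altSum, initialPerms_eq_image, Finset.sum_image hinj.injOn, Finset.sum_mul,
    Nat.add_sub_cancel_left]
  refine Finset.sum_congr rfl fun α _ => ?_
  rw [tailCycle_eq_blockPerm, hmul, permTrace_blockPerm, permTrace_finRotate_inv, sign_blockPerm,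
    Equiv.Perm.sign_one, mul_one, smul_mul_assoc]

end Recursion

/-- the recursion
`k str(𝒜_k M₁⋯M_k) = ∑_{i<k} (-1)^{k+i+1} str(𝒜_i M₁⋯M_i) str(M^{[k-i]})`. -/
theorem stmt14 (m n k : ℕ) (q : ℂ) (hq : q ≠ 0) (A : Type*) [Ring A] [Algebra ℂ A]
    (M : Matrix (Fin (m + n)) (Fin (m + n)) A) (hM : IsManin2 q m M) :
    (k : ℂ) • strAll m (cmap (AqS q m (Finset.univ : Finset (Fin k))) * MProd m M k)
      = ∑ i ∈ Finset.range k, ((-1 : ℂ) ^ (k + i + 1)) •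
          (strAll m (cmap (AqS q m (Finset.univ : Finset (Fin i))) * MProd m M i) *
            strM m (Mpow q m M (k - i))) := by
  cases k with
  | zero => simp
  | succ K =>
    have hτ : ManinTrace (permTrace q m M : Equiv.Perm (Fin (K + 1)) → A) :=
      permTrace_maninTrace hq m M (manin_slots hM)
    have hrec := hτ.altSum_tailCycle K (Nat.lt_succ_self K)
    have huniv : initialPerms (K + 1) (K + 1) = Finset.univ := by
      ext σ
      simp only [mem_initialPerms, Finset.mem_univ, iff_true]
      intro t ht
      omega
    have hf : ((K + 1 : ℕ) : ℂ) * ((K + 1).factorial : ℂ)⁻¹ = (K.factorial : ℂ)⁻¹ := by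
      rw [Nat.factorial_succ, Nat.cast_mul, mul_inv, ← mul_assoc,
        mul_inv_cancel₀ (Nat.cast_ne_zero.2 K.succ_ne_zero), one_mul]
    rw [tailCycle_last, altSum, huniv] at hrec
    simp only [one_mul] at hrec
    rw [strAll_AqS, smul_smul, hf, hrec]
    refine Finset.sum_congr rfl fun l hl => ?_
    rw [altSum_permTrace q m M (Finset.mem_range.1 hl), strAll_AqS, smul_mul_assoc]
    congr 1
    apply neg_one_pow_congr_zmod
    push_cast
    generalize (K : ZMod 2) = x
    generalize (l : ZMod 2) = y
    decide +revert

end QSM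
end

section
/- (Quasideterminant decomposition of the quantum Berezinian) In the Hopf superalgebra \widetilde{\mathcal{M}}_{m|n}, the quantum Berezinian factors as Ber_q(M) = |M^{(1)}|_{11} \cdots |M^{(m)}|_{mm} \, |M^{(m+1)}|^{-1}_{m+1,m+1} \cdots |M^{(m+n)}|^{-1}_{m+n,m+n}, where M^{(k)} is the leading principal k\times k submatrix of M. -/
open scoped BigOperators Classical
open Finset

namespace QSM

variable {B : Type*} [Ring B] [Algebra ℂ B]

section QuantumDeterminant

/-- The permutation of `Fin (r + 1)` sending `c` to `p` and acting as `τ` on the remaining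
indices, identified with `Fin r` in increasing order. -/
def extendPerm {r : ℕ} (c p : Fin (r + 1)) (τ : Equiv.Perm (Fin r)) :
    Equiv.Perm (Fin (r + 1)) :=
  (finSuccEquiv' c).trans (τ.optionCongr.trans (finSuccEquiv' p).symm)

@[simp]
theorem extendPerm_self {r : ℕ} (c p : Fin (r + 1)) (τ : Equiv.Perm (Fin r)) :
    extendPerm c p τ c = p := by
  simp [extendPerm]

@[simp]
theorem extendPerm_succAbove {r : ℕ} (c p : Fin (r + 1)) (τ : Equiv.Perm (Fin r)) (i : Fin r) :
    extendPerm c p τ (c.succAbove i) = p.succAbove (τ i) := by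
  simp [extendPerm]

theorem extendPerm_bijective {r : ℕ} (c : Fin (r + 1)) :
    Function.Bijective
      (fun x : Fin (r + 1) × Equiv.Perm (Fin r) => extendPerm c x.1 x.2) := by
  rw [Fintype.bijective_iff_injective_and_card]
  constructor
  · rintro ⟨p, τ⟩ ⟨p', τ'⟩ h
    have hp : p = p' := by
      have := congrArg (fun σ : Equiv.Perm (Fin (r + 1)) => σ c) h
      simpa using this
    subst hp
    have hτ : τ = τ' := by
      ext1 i
      have := congrArg (fun σ : Equiv.Perm (Fin (r + 1)) => σ (c.succAbove i)) h
      simpa using this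
    rw [hτ]
  · simp [Fintype.card_perm, Nat.factorial_succ]

theorem sum_perm_eq_sum_extendPerm {r : ℕ} {β : Type*} [AddCommMonoid β] (c : Fin (r + 1))
    (f : Equiv.Perm (Fin (r + 1)) → β) :
    ∑ σ, f σ = ∑ p, ∑ τ, f (extendPerm c p τ) := by
  rw [← Fintype.sum_prod_type']
  exact ((extendPerm_bijective c).sum_comp f).symm

theorem invCount_eq_sum {r : ℕ} (σ : Equiv.Perm (Fin r)) :
    invCount σ = ∑ a, ∑ b, if a < b ∧ σ b < σ a then 1 else 0 := by
  rw [invCount, Finset.card_filter, Fintype.sum_prod_type]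

theorem card_filter_castSucc_lt {r : ℕ} (p : Fin (r + 1)) :
    (Finset.univ.filter fun i : Fin r => i.castSucc < p).card = p := by
  have := Fin.card_filter_val_lt (n := r) (m := p)
  simpa [Fin.lt_def, Nat.min_eq_right p.is_le] using this

theorem invCount_extendPerm_zero {r : ℕ} (p : Fin (r + 1)) (τ : Equiv.Perm (Fin r)) :
    invCount (extendPerm 0 p τ) = p + invCount τ := by
  have hs : ∀ i : Fin r, extendPerm 0 p τ i.succ = p.succAbove (τ i) := fun i => by
    simpa using extendPerm_succAbove 0 p τ i
  simp only [invCount_eq_sum, Fin.sum_univ_succ, hs, extendPerm_self, Fin.succ_lt_succ_iff,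
    Fin.succAbove_lt_succAbove_iff, Fin.succ_pos, true_and, false_and, if_false,
    Fin.not_lt_zero, zero_add]
  congr 1
  rw [Equiv.sum_comp τ (fun i => if p.succAbove i < p then 1 else 0)]
  simp only [Fin.succAbove_lt_iff_castSucc_lt]
  rw [← Finset.card_filter, card_filter_castSucc_lt]

theorem invCount_extendPerm_last {r : ℕ} (p : Fin (r + 1)) (τ : Equiv.Perm (Fin r)) :
    invCount (extendPerm (Fin.last r) p τ) = (r - p) + invCount τ := by
  have hs : ∀ i : Fin r, extendPerm (Fin.last r) p τ i.castSucc = p.succAbove (τ i) := fun i => by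
    simpa using extendPerm_succAbove (Fin.last r) p τ i
  simp only [invCount_eq_sum, Fin.sum_univ_castSucc, hs, extendPerm_self,
    Fin.castSucc_lt_castSucc_iff, Fin.succAbove_lt_succAbove_iff, Fin.castSucc_lt_last, true_and,
    lt_irrefl, false_and, if_false, add_zero, Finset.sum_add_distrib,
    (Fin.castSucc_lt_last _).not_gt, Finset.sum_const_zero]
  rw [add_comm]
  congr 1
  rw [Equiv.sum_comp τ (fun i => if p < p.succAbove i then 1 else 0)]
  simp only [Fin.lt_succAbove_iff_le_castSucc]
  have h := Finset.card_filter_add_card_filter_not (s := (Finset.univ : Finset (Fin r)))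
    (fun i => i.castSucc < p)
  rw [card_filter_castSucc_lt] at h
  simp only [not_lt, Finset.card_univ, Fintype.card_fin] at h
  rw [← Finset.card_filter]
  omega

theorem swap_zero_one_succ_succ {r : ℕ} (i : Fin r) :
    Equiv.swap (0 : Fin (r + 2)) 1 i.succ.succ = i.succ.succ :=
  Equiv.swap_apply_of_ne_of_ne (Fin.succ_ne_zero _)
    fun hi => Fin.succ_ne_zero i (Fin.succ_injective _ hi)

theorem invCount_mul_swap {r : ℕ} (σ : Equiv.Perm (Fin (r + 2))) (h : σ 0 < σ 1) :
    invCount (σ * Equiv.swap 0 1) = invCount σ + 1 := by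
  simp only [invCount_eq_sum, Fin.sum_univ_succ, Equiv.Perm.mul_apply, Fin.succ_zero_eq_one,
    Equiv.swap_apply_left, Equiv.swap_apply_right, swap_zero_one_succ_succ]
  simp [h, h.not_gt, Fin.one_lt_succ_succ]
  omega

theorem detq_eq_sum (q : ℂ) {r : ℕ} (A : Matrix (Fin r) (Fin r) B) :
    detq q A = ∑ σ : Equiv.Perm (Fin r),
      ((-q)⁻¹ ^ invCount σ) • (List.ofFn fun i : Fin r => A (σ i) i).prod := by
  simp only [detq, zpow_neg, zpow_natCast, inv_pow]

theorem detq_zero (q : ℂ) (A : Matrix (Fin 0) (Fin 0) B) : detq q A = 1 := by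
  rw [detq_eq_sum]
  simp [invCount]

/-- Expansion of the quantum determinant along the first column. -/
theorem detq_expand_first (q : ℂ) {r : ℕ} (A : Matrix (Fin (r + 1)) (Fin (r + 1)) B) :
    detq q A = ∑ p : Fin (r + 1),
      A p 0 * ((-q)⁻¹ ^ (p : ℕ) • detq q (A.submatrix p.succAbove Fin.succ)) := by
  rw [detq_eq_sum, sum_perm_eq_sum_extendPerm 0]
  refine Finset.sum_congr rfl fun p _ => ?_
  rw [detq_eq_sum, Finset.smul_sum, Finset.mul_sum]
  refine Finset.sum_congr rfl fun τ _ => ?_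
  have hs : ∀ i : Fin r, extendPerm 0 p τ i.succ = p.succAbove (τ i) := fun i => by
    simpa using extendPerm_succAbove 0 p τ i
  rw [invCount_extendPerm_zero, List.ofFn_succ, List.prod_cons, smul_smul, ← pow_add,
    mul_smul_comm]
  simp [hs]

/-- Expansion of the quantum determinant along the last column. -/
theorem detq_expand_last (q : ℂ) {r : ℕ} (A : Matrix (Fin (r + 1)) (Fin (r + 1)) B) :
    detq q A = ∑ p : Fin (r + 1),
      ((-q)⁻¹ ^ (r - (p : ℕ)) • detq q (A.submatrix p.succAbove Fin.castSucc)) *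
        A p (Fin.last r) := by
  rw [detq_eq_sum, sum_perm_eq_sum_extendPerm (Fin.last r)]
  refine Finset.sum_congr rfl fun p _ => ?_
  rw [detq_eq_sum, Finset.smul_sum, Finset.sum_mul]
  refine Finset.sum_congr rfl fun τ _ => ?_
  have hs : ∀ i : Fin r, extendPerm (Fin.last r) p τ i.castSucc = p.succAbove (τ i) := fun i => by
    simpa using extendPerm_succAbove (Fin.last r) p τ i
  rw [invCount_extendPerm_last, List.ofFn_succ_last, List.prod_append, smul_smul, ← pow_add,
    smul_mul_assoc]
  simp [hs]

/-- The cross relations of a `q`-Manin matrix: the `2 × 2` quantum minors are quantum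
antisymmetric in their columns. -/
def CrossRel (q : ℂ) {r : ℕ} {κ : Type*} (t : κ → κ → ℂ) (A : Matrix (Fin r) κ B) : Prop :=
  ∀ a b, a < b → ∀ c e,
    A a c * A b e + (-q)⁻¹ • (A b c * A a e) =
      -(t c e • (A a e * A b c + (-q)⁻¹ • (A b e * A a c)))

theorem CrossRel.submatrix {q : ℂ} {r r' : ℕ} {κ κ' : Type*} {t : κ → κ → ℂ}
    {A : Matrix (Fin r) κ B} (h : CrossRel q t A) {f : Fin r' → Fin r} (hf : StrictMono f)
    (g : κ' → κ) : CrossRel q (fun c e => t (g c) (g e)) (A.submatrix f g) :=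
  fun _ _ hab c e => h _ _ (hf hab) (g c) (g e)

theorem CrossRel.detq_swap {q : ℂ} {r : ℕ} {κ : Type*} {t : κ → κ → ℂ}
    {A : Matrix (Fin (r + 2)) κ B} (h : CrossRel q t A) (g : Fin (r + 2) → κ) :
    detq q (A.submatrix id g) =
      -(t (g 0) (g 1) • detq q (A.submatrix id (g ∘ Equiv.swap 0 1))) := by
  let F : (Fin (r + 2) → κ) → Equiv.Perm (Fin (r + 2)) → B := fun g σ =>
    (-q)⁻¹ ^ invCount σ • (List.ofFn fun i => A (σ i) (g i)).prod
  have key : ∀ g : Fin (r + 2) → κ, (2 : ℂ) • detq q (A.submatrix id g) =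
      ∑ σ, (F g σ + F g (σ * Equiv.swap 0 1)) := by
    intro g
    have hsum : ∑ σ, F g (σ * Equiv.swap 0 1) = ∑ σ, F g σ :=
      Equiv.sum_comp (Equiv.mulRight (Equiv.swap (0 : Fin (r + 2)) 1)) (F g)
    rw [Finset.sum_add_distrib, hsum, two_smul, detq_eq_sum]
    rfl
  have lt_case : ∀ σ : Equiv.Perm (Fin (r + 2)), σ 0 < σ 1 →
      F g σ + F g (σ * Equiv.swap 0 1) = -(t (g 0) (g 1) •
        (F (g ∘ Equiv.swap 0 1) σ + F (g ∘ Equiv.swap 0 1) (σ * Equiv.swap 0 1))) := by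
    intro σ hσ
    have hr := congrArg
      (fun x => (-q)⁻¹ ^ invCount σ •
        (x * (List.ofFn fun i : Fin r => A (σ i.succ.succ) (g i.succ.succ)).prod))
      (h _ _ hσ (g 0) (g 1))
    simp only [F, invCount_mul_swap σ hσ, List.ofFn_succ, List.prod_cons, Equiv.Perm.mul_apply,
      Function.comp_apply, Fin.succ_zero_eq_one, Equiv.swap_apply_left, Equiv.swap_apply_right,
      swap_zero_one_succ_succ, pow_succ, mul_smul, ← smul_add]
    simp only [← mul_assoc, ← smul_mul_assoc, ← add_mul]
    simp only [neg_mul, smul_neg, smul_mul_assoc] at hr ⊢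
    rw [hr, smul_comm]
  have all_case : ∀ σ : Equiv.Perm (Fin (r + 2)),
      F g σ + F g (σ * Equiv.swap 0 1) = -(t (g 0) (g 1) •
        (F (g ∘ Equiv.swap 0 1) σ + F (g ∘ Equiv.swap 0 1) (σ * Equiv.swap 0 1))) := by
    intro σ
    rcases lt_trichotomy (σ 0) (σ 1) with hσ | hσ | hσ
    · exact lt_case σ hσ
    · exact absurd (σ.injective hσ) (by simp)
    · have := lt_case (σ * Equiv.swap 0 1) (by simpa using hσ)
      rw [mul_assoc, Equiv.swap_mul_self, mul_one] at this
      rw [add_comm, this, add_comm (F (g ∘ Equiv.swap 0 1) σ)]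
  have h4 : (2 : ℂ) • detq q (A.submatrix id g) =
      (2 : ℂ) • -(t (g 0) (g 1) • detq q (A.submatrix id (g ∘ Equiv.swap 0 1))) := by
    rw [smul_neg, smul_comm, key, key, Finset.smul_sum, ← Finset.sum_neg_distrib]
    exact Finset.sum_congr rfl fun σ _ => all_case σ
  exact smul_right_injective B (two_ne_zero : (2 : ℂ) ≠ 0) h4

/-- A quantum determinant with a repeated column vanishes. -/
theorem CrossRel.detq_eq_zero {q : ℂ} {κ : Type*} {t : κ → κ → ℂ} (ht : ∀ c, t c c = 1)
    {r : ℕ} {A : Matrix (Fin r) κ B} (h : CrossRel q t A) (g : Fin r → κ)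
    (hg : ¬ Function.Injective g) : detq q (A.submatrix id g) = 0 := by
  induction r with
  | zero => exact absurd (Function.injective_of_subsingleton g) hg
  | succ r ih =>
    have tail : ∀ g : Fin (r + 1) → κ, ¬ Function.Injective (g ∘ Fin.succ) →
        detq q (A.submatrix id g) = 0 := by
      intro g hg
      rw [detq_expand_first]
      refine Finset.sum_eq_zero fun p _ => ?_
      have := ih (h.submatrix (Fin.strictMono_succAbove p) id) (g ∘ Fin.succ) hg
      rw [Matrix.submatrix_submatrix] at this ⊢
      rw [show id ∘ p.succAbove = p.succAbove ∘ id from rfl,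
        show g ∘ Fin.succ = id ∘ g ∘ Fin.succ from rfl, this, smul_zero, mul_zero]
    by_cases hs : Function.Injective (g ∘ Fin.succ)
    · obtain ⟨j, hj⟩ : ∃ j : Fin r, g j.succ = g 0 := by
        by_contra! hne
        refine hg fun a b hab => ?_
        induction a using Fin.cases with
        | zero =>
          induction b using Fin.cases with
          | zero => rfl
          | succ b => exact absurd hab.symm (hne b)
        | succ a =>
          induction b using Fin.cases with
          | zero => exact absurd hab (hne a)
          | succ b => exact congrArg Fin.succ (hs hab)
      obtain _ | r := r
      · exact j.elim0
      rw [h.detq_swap g]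
      induction j using Fin.cases with
      | zero =>
        rw [Fin.succ_zero_eq_one] at hj
        have hc : g ∘ Equiv.swap 0 1 = g := by
          ext1 i
          rw [Function.comp_apply, Equiv.swap_apply_def]
          split_ifs with h0 h1 <;> simp [*]
        have hd := h.detq_swap g
        rw [hc, hj, ht, one_smul] at hd
        rw [hc, hj, ht, one_smul, ← hd]
        have h2 : (2 : ℂ) • detq q (A.submatrix id g) = 0 := by
          rw [two_smul]
          nth_rewrite 1 [hd]
          exact neg_add_cancel _
        exact (smul_eq_zero_iff_right two_ne_zero).1 h2
      | succ j =>
        rw [tail, smul_zero, neg_zero]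
        intro hi
        have : (0 : Fin (r + 1)) = j.succ := hi (by
          simp only [Function.comp_apply, Fin.succ_zero_eq_one, Equiv.swap_apply_right]
          rw [swap_zero_one_succ_succ, hj])
        exact Fin.succ_ne_zero j this.symm
    · exact tail g hs

/-- The bottom right entry of a right inverse relates the quantum determinant to its
leading principal minor. -/
theorem CrossRel.detq_castSucc {q : ℂ} {r : ℕ} {t : Fin (r + 1) → Fin (r + 1) → ℂ}
    (ht : ∀ c, t c c = 1) {A N : Matrix (Fin (r + 1)) (Fin (r + 1)) B} (h : CrossRel q t A)
    (hN : A * N = 1) :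
    detq q (A.submatrix Fin.castSucc Fin.castSucc) = detq q A * N (Fin.last r) (Fin.last r) := by
  set cof : Fin (r + 1) → B := fun p =>
    (-q)⁻¹ ^ (r - (p : ℕ)) • detq q (A.submatrix p.succAbove Fin.castSucc) with hcof
  have hrow : ∀ j : Fin (r + 1), ∑ p, cof p * A p j = if j = Fin.last r then detq q A else 0 := by
    intro j
    split_ifs with hj
    · rw [hj, detq_expand_last q A]
    · have hz := h.detq_eq_zero ht (Fin.snoc Fin.castSucc j : Fin (r + 1) → Fin (r + 1)) (by
        intro hi
        have hlt : (j : ℕ) < r := lt_of_le_of_ne (Fin.is_le j) fun hh => hj (Fin.ext hh)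
        have := @hi (Fin.last r) (Fin.castSucc ⟨j, hlt⟩)
          (by rw [Fin.snoc_last, Fin.snoc_castSucc]; rfl)
        exact absurd this (Fin.castSucc_lt_last _).ne')
      rw [detq_expand_last] at hz
      rw [← hz]
      refine Finset.sum_congr rfl fun p _ => ?_
      rw [hcof, Matrix.submatrix_submatrix]
      congr 4
      · simp
      · simp
  have h1 : ∑ j, (∑ p, cof p * A p j) * N j (Fin.last r) = cof (Fin.last r) := by
    simp only [Finset.sum_mul]
    rw [Finset.sum_comm]
    simp only [mul_assoc, ← Finset.mul_sum, ← Matrix.mul_apply, hN, Matrix.one_apply, mul_ite,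
      mul_one, mul_zero, Finset.sum_ite_eq', Finset.mem_univ, if_true]
  have h2 : cof (Fin.last r) = detq q (A.submatrix Fin.castSucc Fin.castSucc) := by
    simp only [hcof, Fin.val_last, Nat.sub_self, pow_zero, one_smul]
    congr 2
    exact funext fun i => by simp
  rw [← h2, ← h1]
  simp [hrow]

/-- If `v 0 = 1` and `v` times the transpose of `A` vanishes outside position `0`, the
quantum determinant factors through the trailing principal minor. -/
theorem CrossRel.detq_succ {q : ℂ} {r : ℕ} {t : Fin (r + 1) → Fin (r + 1) → ℂ}
    (ht : ∀ c, t c c = 1) {A : Matrix (Fin (r + 1)) (Fin (r + 1)) B} (h : CrossRel q t A)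
    (v : Fin (r + 1) → B) (x : B) (hv : v 0 = 1)
    (hA : ∀ l, ∑ j, v j * A l j = if l = 0 then x else 0) :
    detq q A = x * detq q (A.submatrix Fin.succ Fin.succ) := by
  set cof : Fin (r + 1) → B := fun p =>
    (-q)⁻¹ ^ (p : ℕ) • detq q (A.submatrix p.succAbove Fin.succ) with hcof
  have hcol : ∀ j : Fin (r + 1), ∑ p, A p j * cof p = if j = 0 then detq q A else 0 := by
    intro j
    split_ifs with hj
    · rw [hj, detq_expand_first q A]
    · have hz := h.detq_eq_zero ht (Fin.cons j Fin.succ : Fin (r + 1) → Fin (r + 1)) (by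
        intro hi
        obtain ⟨k, rfl⟩ := Fin.exists_succ_eq.2 hj
        have := @hi 0 k.succ (by simp)
        exact Fin.succ_ne_zero _ this.symm)
      rw [detq_expand_first] at hz
      rw [← hz]
      rfl
  have h1 : ∑ j, v j * ∑ p, A p j * cof p = x * cof 0 := by
    simp only [Finset.mul_sum, ← mul_assoc]
    rw [Finset.sum_comm]
    simp only [← Finset.sum_mul, hA]
    simp
  have h2 : cof 0 = detq q (A.submatrix Fin.succ Fin.succ) := by
    simp only [hcof, Fin.val_zero, pow_zero, one_smul]
    congr 2
  rw [← h2, ← h1]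
  simp [hcol, hv]


theorem ManinRel.crossRel_even {m n : ℕ} {q : ℂ} (hq : q ≠ 0)
    {M : Matrix (Fin (m + n)) (Fin (m + n)) B} (hM : ManinRel q m M) :
    CrossRel q (fun c e => q ^ eps e c)
      (M.submatrix (Fin.castAdd n) (Fin.castAdd n) : Matrix (Fin m) (Fin m) B) := by
  intro a b hab c e
  have h := hM.2.2.2 (Fin.castAdd n a) (Fin.castAdd n c) (Fin.castAdd n b) (Fin.castAdd n e)
  have hp : ∀ i : Fin m, pa m (Fin.castAdd n i) = 0 := fun i => by simp [pa]
  have he : ∀ i j : Fin m, eps (Fin.castAdd n i) (Fin.castAdd n j) = eps i j := fun _ _ => rfl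
  have hab' : eps a b = -1 := by
    rw [Fin.lt_def] at hab
    simp [eps, hab, hab.not_gt]
  simp only [hp, he, hab', zpow_add₀ hq, zpow_neg_one] at h
  simp only [Nat.mul_zero, Nat.add_zero, pow_zero, mul_one] at h
  simp only [Matrix.submatrix_apply, inv_neg, neg_smul, smul_add, smul_neg, smul_smul]
  rw [sub_eq_iff_eq_add] at h
  rw [h, mul_comm (q ^ eps e c)]
  abel

theorem ManinRel.crossRel_odd {m n : ℕ} {q : ℂ} (hq : q ≠ 0)
    {Y : Matrix (Fin (m + n)) (Fin (m + n)) B} (hY : ManinRel q⁻¹ m Y) :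
    CrossRel q (fun c e => q ^ eps e c)
      (Y.transpose.submatrix (Fin.natAdd m) (Fin.natAdd m) : Matrix (Fin n) (Fin n) B) := by
  intro a b hab c e
  have h := hY.2.2.2 (Fin.natAdd m c) (Fin.natAdd m a) (Fin.natAdd m e) (Fin.natAdd m b)
  have hp : ∀ i : Fin n, pa m (Fin.natAdd m i) = 1 := fun i => by simp [pa]
  have he : ∀ i j : Fin n, eps (Fin.natAdd m i) (Fin.natAdd m j) = eps i j := fun i j => by
    simp [eps]
  have hn : eps c e = -eps e c := by
    unfold eps
    split_ifs <;> omega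
  have hab' : eps b a = 1 := by
    rw [Fin.lt_def] at hab
    simp [eps, hab]
  have hq' : q⁻¹ ≠ 0 := inv_ne_zero hq
  simp only [hp, he, hab', hn, zpow_add₀ hq', zpow_one, inv_zpow', neg_neg] at h
  norm_num at h
  simp only [Matrix.submatrix_apply, Matrix.transpose_apply, inv_neg, neg_smul, smul_add,
    smul_neg, smul_smul]
  rw [sub_eq_iff_eq_add] at h
  rw [h]
  abel


theorem ManinRel.detq_leading {m n : ℕ} {q : ℂ} (hq : q ≠ 0)
    {M : Matrix (Fin (m + n)) (Fin (m + n)) B} (hM : ManinRel q m M)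
    {Nk : (k : Fin (m + n)) → Matrix (Fin ((k : ℕ) + 1)) (Fin ((k : ℕ) + 1)) B}
    (hNk : ∀ k : Fin (m + n),
      M.submatrix (Fin.castLE k.isLt) (Fin.castLE k.isLt) * Nk k = 1)
    {d : Fin (m + n) → B}
    (hd : ∀ k : Fin (m + n), Nk k (Fin.last _) (Fin.last _) * d k = 1)
    (r : ℕ) (hr : r ≤ m) (hr' : r ≤ m + n) :
    detq q (M.submatrix (Fin.castLE hr') (Fin.castLE hr')) =
      (List.ofFn fun i : Fin r => d (Fin.castLE hr' i)).prod := by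
  induction r with
  | zero => simp [detq_zero]
  | succ r ih =>
    have hA := (hM.crossRel_even hq).submatrix (Fin.strictMono_castLE hr) (Fin.castLE hr)
    have hstep := hA.detq_castSucc (fun c => by simp [eps]) (hNk ⟨r, hr'⟩)
    rw [List.ofFn_succ_last, List.prod_append, List.prod_singleton]
    have ih' := ih (by omega) (by omega)
    have h1 : detq q (M.submatrix (Fin.castLE hr') (Fin.castLE hr')) =
        detq q (M.submatrix (Fin.castLE (by omega : r ≤ m + n)) (Fin.castLE (by omega))) *
          d ⟨r, hr'⟩ := by
      have h2 := congrArg (· * d ⟨r, hr'⟩) hstep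
      simp only [mul_assoc] at h2
      rw [hd ⟨r, hr'⟩, mul_one] at h2
      exact h2.symm
    rw [h1, ih']
    rfl

theorem ManinRel.detq_trailing {m n : ℕ} {q : ℂ} (hq : q ≠ 0)
    {M Y : Matrix (Fin (m + n)) (Fin (m + n)) B} (hY : ManinRel q⁻¹ m Y) (hMY : M * Y = 1)
    {Nk : (k : Fin (m + n)) → Matrix (Fin ((k : ℕ) + 1)) (Fin ((k : ℕ) + 1)) B}
    (hNk : ∀ k : Fin (m + n),
      Nk k * M.submatrix (Fin.castLE k.isLt) (Fin.castLE k.isLt) = 1)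
    {x : Fin (m + n) → B} (hx : ∀ k, x k = Nk k (Fin.last _) (Fin.last _))
    (r c : ℕ) (hc : c + r = n) :
    detq q (Y.transpose.submatrix (fun i : Fin r => (⟨m + c + i, by omega⟩ : Fin (m + n)))
        (fun i : Fin r => ⟨m + c + i, by omega⟩)) =
      (List.ofFn fun i : Fin r => x ⟨m + c + i, by omega⟩).prod := by
  induction r generalizing c with
  | zero => simp [detq_zero]
  | succ r ih =>
    have hmono : StrictMono (fun i : Fin (r + 1) => (⟨c + i, by omega⟩ : Fin n)) :=
      fun a b hab => Nat.add_lt_add_left hab c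
    have hA := (hY.crossRel_odd hq).submatrix hmono
      (fun i : Fin (r + 1) => (⟨c + i, by omega⟩ : Fin n))
    set k : Fin (m + n) := ⟨m + c, by omega⟩ with hk
    let u : Fin (m + n) → B := fun j =>
      ∑ i, Nk k (Fin.last _) i * M (Fin.castLE k.isLt i) j
    have hu : ∀ i, u (Fin.castLE k.isLt i) = if i = Fin.last _ then 1 else 0 := by
      intro i
      have := congrFun (congrFun (hNk k) (Fin.last _)) i
      rw [Matrix.one_apply] at this
      simp only [eq_comm (b := Fin.last _)]
      exact this
    have huY : ∀ l, ∑ j, u j * Y j l =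
        ∑ i, if Fin.castLE k.isLt i = l then Nk k (Fin.last _) i else 0 := by
      intro l
      simp only [u, Finset.sum_mul, mul_assoc]
      rw [Finset.sum_comm]
      simp only [← Finset.mul_sum, ← Matrix.mul_apply, hMY, Matrix.one_apply, mul_ite, mul_one,
        mul_zero]
    let f : Fin (r + 1) → Fin (m + n) := fun i => ⟨m + c + i, by omega⟩
    have hf : ∀ i, f i = Fin.natAdd m ⟨c + i, by omega⟩ := fun i =>
      Fin.ext (by simp [f, add_assoc])
    have hsum : ∀ l, ∑ j, u j * Y j l = ∑ i, u (f i) * Y (f i) l := by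
      intro l
      symm
      refine Finset.sum_of_injOn f ?_ (by simp) ?_ (fun _ _ => rfl)
      · intro a _ b _ hab
        simpa [f, Fin.ext_iff] using hab
      · intro j _ hj
        have hjk : (j : ℕ) < m + c := by
          by_contra! hle
          refine hj ⟨⟨j - (m + c), by omega⟩, by simp, ?_⟩
          ext
          simp [f]
          omega
        have := hu ⟨j, by simp [hk]; omega⟩
        rw [if_neg (by simp [Fin.ext_iff, hk]; omega)] at this
        change u j = 0 at this
        rw [this, zero_mul]
    have hstep := hA.detq_succ (fun c => by simp [eps]) (fun i => u (f i))
      (Nk k (Fin.last _) (Fin.last _))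
      (by
        have := hu (Fin.last _)
        rw [if_pos rfl] at this
        exact this)
      (by
        intro l
        have h := huY (f l)
        rw [hsum] at h
        simp only [Matrix.submatrix_apply, Matrix.transpose_apply, ← hf]
        rw [h]
        split_ifs with hl
        · subst hl
          rw [Finset.sum_eq_single (Fin.last _)]
          · simp [f, hk, Fin.ext_iff]
          · intro i _ hi
            rw [if_neg]
            intro h'
            exact hi (Fin.ext (by simpa [f, hk, Fin.ext_iff] using h'))
          · simp
        · refine Finset.sum_eq_zero fun i _ => ?_
          rw [if_neg]
          intro h'
          have h1 := congrArg Fin.val h'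
          have h2 := i.isLt
          have h3 : (l : ℕ) ≠ 0 := fun h0 => hl (Fin.ext h0)
          simp only [f, hk, Fin.val_castLE] at h1 h2
          omega)
    have ih' := ih (c + 1) (by omega)
    have hs : (fun i : Fin r => (⟨m + (c + 1) + i, by omega⟩ : Fin (m + n))) = f ∘ Fin.succ :=
      funext fun i => Fin.ext (by simp [f]; omega)
    have hx' : (fun i : Fin r => x ⟨m + (c + 1) + i, by omega⟩) = fun i => x (f i.succ) :=
      funext fun i => congrArg x (congrFun hs i)
    have hf' : (fun i : Fin (r + 1) => Fin.natAdd m (⟨c + i, by omega⟩ : Fin n)) = f :=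
      funext fun i => (hf i).symm
    rw [hs, hx'] at ih'
    rw [← hx] at hstep
    rw [List.ofFn_succ, List.prod_cons, ← ih']
    simp only [Matrix.submatrix_submatrix, Function.comp_def, hf'] at hstep
    exact hstep

end QuantumDeterminant

/-- quasideterminant decomposition of the quantum Berezinian. -/
theorem stmt16 (m n : ℕ) (q : ℂ) (hq : q ≠ 0) (A : Type*) [Ring A] [Algebra ℂ A]
    (M Minv : Matrix (Fin (m + n)) (Fin (m + n)) A)
    (hM : ManinRel q m M) (hMinv : ManinRel q⁻¹ m Minv)
    (h1 : M * Minv = 1) (h2 : Minv * M = 1)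
    (Nk : (k : Fin (m + n)) → Matrix (Fin ((k : ℕ) + 1)) (Fin ((k : ℕ) + 1)) A)
    (hNk : ∀ k : Fin (m + n),
      M.submatrix (Fin.castLE k.isLt) (Fin.castLE k.isLt) * Nk k = 1 ∧
      Nk k * M.submatrix (Fin.castLE k.isLt) (Fin.castLE k.isLt) = 1)
    (d : Fin (m + n) → A)
    (hd : ∀ k : Fin (m + n),
      d k * Nk k (Fin.last _) (Fin.last _) = 1 ∧ Nk k (Fin.last _) (Fin.last _) * d k = 1) :
    Ber q m n M Minv =
      (List.ofFn fun i : Fin m => d (Fin.castAdd n i)).prod *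
      (List.ofFn fun j : Fin n => Nk (Fin.natAdd m j) (Fin.last _) (Fin.last _)).prod := by
  have h_even := hM.detq_leading hq (fun k => (hNk k).1) (fun k => (hd k).2) m le_rfl (by omega)
  have h_odd := hMinv.detq_trailing hq h1 (fun k => (hNk k).2)
    (fun _ => rfl) n 0 (by omega)
  exact congrArg₂ (· * ·) h_even h_odd

end QSM
end
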